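/- arXiv:2402.12068 — 4 statements merged into one kernel-verified Lean document; each statement's English description precedes it below -/
import Mathlib

section
/- For every δ ∈ (0,1) and every continuous first-price auction whose subjective priors have piecewise constant densities on [0,1], there exists a discrete first-price auction with the same set of bidders and the same bidding space such that for every ε ≥ 0 and every monotone, non-overbidding ε-well-supported mixed Bayes–Nash equilibrium β of the discrete auction there exists an (ε+δ)-approximate pure Bayes–Nash equilibrium β' of the continuous auction. Moreover, the discrete auction is iid whenever the continuous auction is iid, and β' can be chosen symmetric whenever β is symmetric. -/
open MeasureTheory

open Finset

/-- Ex-post utility of bidder `i` with value `v` under bid profile `bb`: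
`(v - bb i)/|W|` if `i` is among the highest bidders `W` (uniform tie-breaking), else `0`. -/
noncomputable def exPost (n : ℕ) (i : Fin n) (v : ℝ) (bb : Fin n → ℝ) : ℝ :=
  if ∀ k, bb k ≤ bb i then
    (v - bb i) / ((Finset.univ.filter (fun j : Fin n => ∀ k, bb k ≤ bb j)).card : ℝ)
  else 0

/-- Interim utility of bidder `i` bidding `b` with value `v`, when each opponent `j`'s
value is drawn from the prior `f i j` on `V j` and `j` then bids according to the mixed
strategy `β j`. -/
noncomputable def interim (n : ℕ) (V : Fin n → Finset ℝ) (B : Finset ℝ)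
    (f : Fin n → Fin n → ℝ → ℝ) (β : Fin n → ℝ → ℝ → ℝ)
    (i : Fin n) (b : ℝ) (v : ℝ) : ℝ :=
  ∑ bb ∈ Fintype.piFinset (fun j : Fin n => if j = i then ({b} : Finset ℝ) else B),
    (∏ j ∈ Finset.univ.erase i, ∑ w ∈ V j, f i j w * β j w (bb j)) * exPost n i v bb

/-- Interim utility of bidder `i` bidding a mixed bid `γ ∈ Δ(B)` with value `v`. -/
noncomputable def interimMix (n : ℕ) (V : Fin n → Finset ℝ) (B : Finset ℝ)
    (f : Fin n → Fin n → ℝ → ℝ) (β : Fin n → ℝ → ℝ → ℝ)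
    (i : Fin n) (γ : ℝ → ℝ) (v : ℝ) : ℝ :=
  ∑ b ∈ B, γ b * interim n V B f β i b v

/-- `γ` is a probability distribution on the finite bid set `B`. -/
def IsDist (B : Finset ℝ) (γ : ℝ → ℝ) : Prop :=
  (∀ b, 0 ≤ γ b) ∧ ∑ b ∈ B, γ b = 1

/-- `β` is a mixed-strategy profile: each `β i v` is a distribution on `B` for `v ∈ V i`. -/
def IsMixedProfile (n : ℕ) (V : Fin n → Finset ℝ) (B : Finset ℝ)
    (β : Fin n → ℝ → ℝ → ℝ) : Prop :=
  ∀ i : Fin n, ∀ v ∈ V i, IsDist B (β i v)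

/-- No bidder ever puts positive probability on a bid above her value. -/
def NonOverbidding (n : ℕ) (V : Fin n → Finset ℝ) (B : Finset ℝ)
    (β : Fin n → ℝ → ℝ → ℝ) : Prop :=
  ∀ i : Fin n, ∀ v ∈ V i, ∀ b ∈ B, v < b → β i v b = 0

/-- A mixed strategy is monotone: every bid in the support at a lower value is at most
every bid in the support at a higher value. -/
def MonotoneStrat (V B : Finset ℝ) (β0 : ℝ → ℝ → ℝ) : Prop :=
  ∀ v ∈ V, ∀ v' ∈ V, v < v' → ∀ b ∈ B, ∀ b' ∈ B, 0 < β0 v b → 0 < β0 v' b' → b ≤ b'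

/-- Well-formedness of the subjective priors: for `i ≠ j`, `f i j` is a pmf on `V j`. -/
def IsPrior (n : ℕ) (V : Fin n → Finset ℝ) (f : Fin n → Fin n → ℝ → ℝ) : Prop :=
  ∀ i j : Fin n, i ≠ j →
    (∀ v, 0 ≤ f i j v) ∧ (∀ v, v ∉ V j → f i j v = 0) ∧ ∑ v ∈ V j, f i j v = 1

/-- `β` is an ε-approximate mixed Bayes–Nash equilibrium. -/
def MBNE (n : ℕ) (V : Fin n → Finset ℝ) (B : Finset ℝ)
    (f : Fin n → Fin n → ℝ → ℝ) (β : Fin n → ℝ → ℝ → ℝ) (ε : ℝ) : Prop :=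
  ∀ i : Fin n, ∀ v ∈ V i, ∀ γ : ℝ → ℝ, IsDist B γ →
    interimMix n V B f β i (β i v) v ≥ interimMix n V B f β i γ v - ε

/-- `β` is an ε-well-supported mixed Bayes–Nash equilibrium. -/
def WSMBNE (n : ℕ) (V : Fin n → Finset ℝ) (B : Finset ℝ)
    (f : Fin n → Fin n → ℝ → ℝ) (β : Fin n → ℝ → ℝ → ℝ) (ε : ℝ) : Prop :=
  ∀ i : Fin n, ∀ v ∈ V i, ∀ b ∈ B, 0 < β i v b → ∀ γ : ℝ → ℝ, IsDist B γ →
    interim n V B f β i b v ≥ interimMix n V B f β i γ v - ε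

/-- A function is piecewise constant if there is a finite set `S` of breakpoints such
that the function is constant on each connected component of `ℝ ∖ S`. -/
def PiecewiseConstant (ρ : ℝ → ℝ) : Prop :=
  ∃ S : Finset ℝ, ∀ x y : ℝ, x ∉ S → y ∉ S →
    (∀ s ∈ S, ¬(x < s ∧ s < y) ∧ ¬(y < s ∧ s < x)) → ρ x = ρ y

/-- `ρ` is a piecewise constant probability density on `[0,1]`. -/
def IsPCDensity (ρ : ℝ → ℝ) : Prop :=
  (∀ x, 0 ≤ ρ x) ∧ (∀ x, x ∉ Set.Icc (0:ℝ) 1 → ρ x = 0) ∧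
    (∫ x, ρ x = 1) ∧ PiecewiseConstant ρ

/-- Interim utility of bidder `i` bidding `b` with value `v` in a continuous
first-price auction whose subjective priors have densities `ρ i j`: each opponent
`j`'s value is drawn from the density `ρ i j` and mapped through her pure strategy
`β j`. -/
noncomputable def cInterim (n : ℕ) (ρ : Fin n → Fin n → ℝ → ℝ)
    (β : Fin n → ℝ → ℝ) (i : Fin n) (b : ℝ) (v : ℝ) : ℝ :=
  ∫ vv : Fin n → ℝ,
    exPost n i v (Function.update (fun j => β j (vv j)) i b)
    ∂(MeasureTheory.Measure.pi (fun j : Fin n =>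
        if j = i then MeasureTheory.Measure.dirac 0
        else MeasureTheory.volume.withDensity (fun x => ENNReal.ofReal (ρ i j x))))

/-- A pure-strategy profile of the continuous auction: each `β i` is a non-decreasing
(step) function from values in `[0,1]` to bids in `B`, with no overbidding. -/
def CPureProfile (n : ℕ) (B : Finset ℝ) (β : Fin n → ℝ → ℝ) : Prop :=
  ∀ i : Fin n, MonotoneOn (β i) (Set.Icc (0:ℝ) 1) ∧
    ∀ v ∈ Set.Icc (0:ℝ) 1, β i v ∈ B ∧ β i v ≤ v

/-- `β` is an ε-approximate pure Bayes–Nash equilibrium of the continuous auction. -/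
def CPBNE (n : ℕ) (B : Finset ℝ) (ρ : Fin n → Fin n → ℝ → ℝ)
    (β : Fin n → ℝ → ℝ) (ε : ℝ) : Prop :=
  ∀ i : Fin n, ∀ v ∈ Set.Icc (0:ℝ) 1, ∀ b ∈ B,
    cInterim n ρ β i (β i v) v ≥ cInterim n ρ β i b v - ε

/-- The right endpoint of the cell of the partition `P` starting at `w`. -/
noncomputable def nextPoint (P : Finset ℝ) (w : ℝ) : ℝ :=
  (insert (w + 1) (P.filter (w < ·))).min' (insert_nonempty _ _)

/-- The cell of the partition `P` starting at `w`. -/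
noncomputable def cell (P : Finset ℝ) (w : ℝ) : Set ℝ := Set.Ico w (nextPoint P w)

/-- The prior on `P` that collects the mass of each cell at its left endpoint. -/
noncomputable def cellMass (P : Finset ℝ) (ρ : ℝ → ℝ) (w : ℝ) : ℝ :=
  if w ∈ P then ∫ x in cell P w, ρ x else 0

/-- The part of the cell starting at `w` on which the bid `b` is placed. -/
noncomputable def bidCell (P B : Finset ℝ) (β : ℝ → ℝ → ℝ) (w b : ℝ) : Set ℝ :=
  Set.Ico (w + (nextPoint P w - w) * ∑ b' ∈ B with b' < b, β w b')
    (w + (nextPoint P w - w) * (∑ b' ∈ B with b' < b, β w b' + β w b))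

/-- The pure strategy obtained by spreading a mixed strategy over the cells, in increasing
order of bids. -/
noncomputable def spread (P B : Finset ℝ) (β : ℝ → ℝ → ℝ) (x : ℝ) : ℝ :=
  ∑ w ∈ P, ∑ b ∈ B, (bidCell P B β w b).indicator (fun _ => b) x

lemma lt_nextPoint (P : Finset ℝ) (w : ℝ) : w < nextPoint P w := by
  rw [nextPoint, Finset.lt_min'_iff]
  intro y hy
  rcases Finset.mem_insert.1 hy with rfl | h
  · linarith
  · exact (Finset.mem_filter.1 h).2

lemma nextPoint_le {P : Finset ℝ} {w s : ℝ} (hs : s ∈ P) (h : w < s) : nextPoint P w ≤ s :=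
  Finset.min'_le _ _ (by simp [hs, h])

lemma cell_unique {P : Finset ℝ} {w w' x : ℝ} (hw : w ∈ P) (hw' : w' ∈ P)
    (hx : x ∈ cell P w) (hx' : x ∈ cell P w') : w = w' := by
  rcases lt_trichotomy w w' with h | h | h
  · linarith [nextPoint_le hw' h, hx.2, hx'.1]
  · exact h
  · linarith [nextPoint_le hw h, hx'.2, hx.1]

lemma exists_mem_cell {P : Finset ℝ} (h0 : (0 : ℝ) ∈ P) (h1 : (1 : ℝ) ∈ P) {x : ℝ}
    (hx : x ∈ Set.Icc (0 : ℝ) 1) :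
    ∃ w ∈ P, x ∈ cell P w ∧ ∀ s ∈ P, s ≤ x → s ≤ w := by
  have hne : (P.filter (· ≤ x)).Nonempty := ⟨0, by simp [h0, hx.1]⟩
  have hmem := Finset.max'_mem _ hne
  set w := (P.filter (· ≤ x)).max' hne with hw
  obtain ⟨hwP, hwx⟩ := Finset.mem_filter.1 hmem
  have hmax : ∀ s ∈ P, s ≤ x → s ≤ w := fun s hs hsx =>
    Finset.le_max' _ _ (Finset.mem_filter.2 ⟨hs, hsx⟩)
  refine ⟨w, hwP, ⟨hwx, ?_⟩, hmax⟩
  rw [nextPoint, Finset.lt_min'_iff]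
  intro y hy
  rcases Finset.mem_insert.1 hy with rfl | h
  · rcases hx.2.lt_or_eq with h | h
    · linarith [hmax 0 h0 hx.1]
    · linarith [hmax 1 h1 h.ge]
  · obtain ⟨hyP, hwy⟩ := Finset.mem_filter.1 h
    by_contra! hyx
    linarith [hmax y hyP hyx]

lemma IsPCDensity.integrable {ρ : ℝ → ℝ} (h : IsPCDensity ρ) : Integrable ρ := by
  by_contra hn
  have := h.2.2.1
  rw [integral_undef hn] at this
  exact zero_ne_one this

lemma integral_inter_cell_sum {P : Finset ℝ} (h0 : (0 : ℝ) ∈ P) (h1 : (1 : ℝ) ∈ P)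
    {ρ : ℝ → ℝ} (h : IsPCDensity ρ) {A : Set ℝ} (hA : MeasurableSet A) :
    ∫ x in A, ρ x = ∑ w ∈ P, ∫ x in A ∩ cell P w, ρ x := by
  rw [← integral_biUnion_finset]
  · rw [← integral_indicator hA, ← integral_indicator]
    · congr 1
      ext x
      by_cases hx : x ∈ Set.Icc (0 : ℝ) 1
      · obtain ⟨w, hw, hxw, -⟩ := exists_mem_cell h0 h1 hx
        by_cases hxA : x ∈ A
        · rw [Set.indicator_of_mem hxA, Set.indicator_of_mem]
          exact Set.mem_biUnion hw ⟨hxA, hxw⟩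
        · rw [Set.indicator_of_notMem hxA, Set.indicator_of_notMem]
          simp [hxA]
      · simp [Set.indicator, h.2.1 x hx]
    · exact Finset.measurableSet_biUnion _ fun w _ => hA.inter measurableSet_Ico
  · exact fun w _ => hA.inter measurableSet_Ico
  · intro w hw w' hw' hne
    refine Set.disjoint_left.2 fun x hx hx' => hne (cell_unique hw hw' hx.2 hx'.2)
  · exact fun w _ => h.integrable.integrableOn

lemma isPCDensity_cellMass {P : Finset ℝ} (h0 : (0 : ℝ) ∈ P) (h1 : (1 : ℝ) ∈ P)
    {ρ : ℝ → ℝ} (h : IsPCDensity ρ) :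
    (∀ v, 0 ≤ cellMass P ρ v) ∧ (∀ v, v ∉ P → cellMass P ρ v = 0) ∧
      ∑ v ∈ P, cellMass P ρ v = 1 := by
  refine ⟨fun v => ?_, fun v hv => by simp [cellMass, hv], ?_⟩
  · unfold cellMass
    split_ifs
    · exact integral_nonneg h.1
    · exact le_rfl
  · have := integral_inter_cell_sum h0 h1 h MeasurableSet.univ
    simp only [Set.univ_inter, setIntegral_univ, h.2.2.1] at this
    rw [this]
    exact Finset.sum_congr rfl fun w hw => by simp [cellMass, hw]

/-- `ρ` is constant on the components of the complement of `S`. -/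
def ConstOff (S : Finset ℝ) (ρ : ℝ → ℝ) : Prop :=
  ∀ x y : ℝ, x ∉ S → y ∉ S →
    (∀ s ∈ S, ¬(x < s ∧ s < y) ∧ ¬(y < s ∧ s < x)) → ρ x = ρ y

lemma exists_const_on_cell {P S : Finset ℝ} (h1 : (1 : ℝ) ∈ P)
    (hP : ∀ x ∈ P, x ∈ Set.Icc (0 : ℝ) 1) (hSP : ∀ s ∈ S, s ∈ Set.Icc (0 : ℝ) 1 → s ∈ P)
    {ρ : ℝ → ℝ} (h : IsPCDensity ρ) (hS : ConstOff S ρ) {w : ℝ} (hw : w ∈ P) :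
    ∃ c, ∀ x ∈ Set.Ioo w (nextPoint P w), ρ x = c := by
  rcases (hP w hw).2.lt_or_eq with hlt | rfl
  · have hn1 := nextPoint_le h1 hlt
    have hS' : ∀ s ∈ S, w < s → nextPoint P w ≤ s := by
      intro s hs hws
      rcases le_or_gt s 1 with hs1 | hs1
      · exact nextPoint_le (hSP s hs ⟨(hP w hw).1.trans hws.le, hs1⟩) hws
      · linarith
    have hoff : ∀ x ∈ Set.Ioo w (nextPoint P w), x ∉ S := fun x hx hxS => by
      linarith [hS' x hxS hx.1, hx.2]
    have hmid : (w + nextPoint P w) / 2 ∈ Set.Ioo w (nextPoint P w) := by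
      have := lt_nextPoint P w
      constructor <;> linarith
    refine ⟨ρ ((w + nextPoint P w) / 2), fun x hx =>
      hS _ _ (hoff x hx) (hoff _ hmid) fun s hs => ⟨?_, ?_⟩⟩
    · rintro ⟨h1, h2⟩
      linarith [hS' s hs (hx.1.trans h1), hmid.2]
    · rintro ⟨h1, h2⟩
      linarith [hS' s hs (hmid.1.trans h1), hx.2]
  · refine ⟨0, fun x hx => h.2.1 x fun hx' => ?_⟩
    linarith [hx.1, hx'.2]

lemma integral_Ico_of_const {ρ : ℝ → ℝ} {a b w w' c : ℝ} (hc : ∀ x ∈ Set.Ioo w w', ρ x = c)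
    (hwa : w ≤ a) (hab : a ≤ b) (hbw : b ≤ w') : ∫ x in Set.Ico a b, ρ x = (b - a) * c := by
  rw [integral_Ico_eq_integral_Ioo,
    setIntegral_congr_fun (g := fun _ => c) measurableSet_Ioo
      fun x hx => hc x ⟨hwa.trans_lt hx.1, hx.2.trans_le hbw⟩]
  simp [Measure.real, hab]

lemma sum_lt_add_eq_sum_le {B : Finset ℝ} (γ : ℝ → ℝ) {b : ℝ} (hb : b ∈ B) :
    ∑ b' ∈ B with b' < b, γ b' + γ b = ∑ b' ∈ B with b' ≤ b, γ b' := by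
  have : B.filter (· ≤ b) = insert b (B.filter (· < b)) := by
    ext x
    simp only [Finset.mem_filter, Finset.mem_insert]
    grind
  rw [this, Finset.sum_insert (by simp), add_comm]

lemma sum_lt_add_le_sum_lt {B : Finset ℝ} {γ : ℝ → ℝ} (hγ : ∀ b, 0 ≤ γ b) {b b' : ℝ}
    (hb : b ∈ B) (h : b < b') :
    ∑ a ∈ B with a < b, γ a + γ b ≤ ∑ a ∈ B with a < b', γ a := by
  rw [sum_lt_add_eq_sum_le γ hb]
  refine Finset.sum_le_sum_of_subset_of_nonneg (fun a ha => ?_) fun _ _ _ => hγ _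
  simp only [Finset.mem_filter] at ha ⊢
  exact ⟨ha.1, ha.2.trans_lt h⟩

lemma sum_lt_add_le_one {B : Finset ℝ} {γ : ℝ → ℝ} (hγ : IsDist B γ) {b : ℝ} (hb : b ∈ B) :
    ∑ a ∈ B with a < b, γ a + γ b ≤ 1 := by
  rw [sum_lt_add_eq_sum_le γ hb, ← hγ.2]
  exact Finset.sum_le_sum_of_subset_of_nonneg (Finset.filter_subset _ _) fun _ _ _ => hγ.1 _

lemma exists_quantile {B : Finset ℝ} {γ : ℝ → ℝ} (hγ : IsDist B γ) {t : ℝ} (ht0 : 0 ≤ t)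
    (ht1 : t < 1) :
    ∃ b ∈ B, ∑ a ∈ B with a < b, γ a ≤ t ∧ t < ∑ a ∈ B with a < b, γ a + γ b := by
  have hB : B.Nonempty := by
    rw [Finset.nonempty_iff_ne_empty]
    rintro rfl
    simpa using hγ.2
  have hne : (B.filter fun b => t < ∑ a ∈ B with a < b, γ a + γ b).Nonempty := by
    refine ⟨B.max' hB, Finset.mem_filter.2 ⟨B.max'_mem hB, ?_⟩⟩
    rw [sum_lt_add_eq_sum_le γ (B.max'_mem hB),
      Finset.filter_true_of_mem fun a ha => B.le_max' a ha, hγ.2]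
    exact ht1
  obtain ⟨hbB, hb⟩ := Finset.mem_filter.1 (Finset.min'_mem _ hne)
  refine ⟨_, hbB, ?_, hb⟩
  set b := (B.filter fun b => t < ∑ a ∈ B with a < b, γ a + γ b).min' hne with hbdef
  rcases (B.filter (· < b)).eq_empty_or_nonempty with he | he
  · rw [he]
    simpa using ht0
  · obtain ⟨hcB, hcb⟩ := Finset.mem_filter.1 (Finset.max'_mem _ he)
    set c := (B.filter (· < b)).max' he
    have heq : B.filter (· < b) = B.filter (· ≤ c) := by
      ext a
      simp only [Finset.mem_filter]
      refine ⟨fun ha => ⟨ha.1, Finset.le_max' _ _ (Finset.mem_filter.2 ha)⟩, fun ha =>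
        ⟨ha.1, ha.2.trans_lt hcb⟩⟩
    rw [heq, ← sum_lt_add_eq_sum_le γ hcB]
    by_contra! hlt
    have : b ≤ c := Finset.min'_le _ c (by simpa only [Finset.mem_filter] using ⟨hcB, hlt⟩)
    linarith

section Spread

variable {P B : Finset ℝ} {β : ℝ → ℝ → ℝ}

lemma bidCell_subset_cell {w b : ℝ} (hβ : IsDist B (β w)) (hb : b ∈ B) :
    bidCell P B β w b ⊆ cell P w := by
  have hL := lt_nextPoint P w
  refine Set.Ico_subset_Ico ?_ ?_
  · have : 0 ≤ ∑ a ∈ B with a < b, β w a := Finset.sum_nonneg fun _ _ => hβ.1 _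
    nlinarith
  · nlinarith [sum_lt_add_le_one hβ hb]

lemma exists_mem_bidCell {w x : ℝ} (hβ : IsDist B (β w)) (hx : x ∈ cell P w) :
    ∃ b ∈ B, x ∈ bidCell P B β w b := by
  have hL : 0 < nextPoint P w - w := sub_pos.2 (lt_nextPoint P w)
  obtain ⟨b, hb, h1, h2⟩ := exists_quantile hβ (t := (x - w) / (nextPoint P w - w))
    (div_nonneg (sub_nonneg.2 hx.1) hL.le)
    ((div_lt_one hL).2 (by linarith [hx.2]))
  rw [le_div_iff₀ hL] at h1
  rw [div_lt_iff₀ hL] at h2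
  exact ⟨b, hb, by linarith, by linarith⟩

lemma bid_le_of_mem_bidCell {w x y b b' : ℝ} (hβ : IsDist B (β w)) (hb' : b' ∈ B)
    (hx : x ∈ bidCell P B β w b) (hy : y ∈ bidCell P B β w b') (hxy : x ≤ y) : b ≤ b' := by
  by_contra! h
  have hL : 0 < nextPoint P w - w := sub_pos.2 (lt_nextPoint P w)
  have := sum_lt_add_le_sum_lt hβ.1 hb' h
  nlinarith [hx.1, hy.2]

lemma pos_of_mem_bidCell {w x b : ℝ} (hx : x ∈ bidCell P B β w b) : 0 < β w b := by
  have hL : 0 < nextPoint P w - w := sub_pos.2 (lt_nextPoint P w)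
  have := hx.1.trans_lt hx.2
  by_contra! h
  nlinarith

lemma spread_eq {w x b : ℝ} (hβ : ∀ v ∈ P, IsDist B (β v)) (hw : w ∈ P) (hb : b ∈ B)
    (hx : x ∈ bidCell P B β w b) : spread P B β x = b := by
  have hxw := bidCell_subset_cell (hβ w hw) hb hx
  rw [spread, Finset.sum_eq_single_of_mem w hw, Finset.sum_eq_single_of_mem b hb,
    Set.indicator_of_mem hx]
  · intro b' hb' hne
    refine Set.indicator_of_notMem (fun hx' => hne ?_) _
    exact le_antisymm (bid_le_of_mem_bidCell (hβ w hw) hb hx' hx le_rfl)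
      (bid_le_of_mem_bidCell (hβ w hw) hb' hx hx' le_rfl)
  · intro w' hw' hne
    refine Finset.sum_eq_zero fun b' hb' => Set.indicator_of_notMem (fun hx' => hne ?_) _
    exact cell_unique hw' hw (bidCell_subset_cell (hβ w' hw') hb' hx') hxw

lemma spread_mem (h0 : (0 : ℝ) ∈ B) (hβ : ∀ v ∈ P, IsDist B (β v)) (x : ℝ) :
    spread P B β x ∈ B := by
  by_cases h : ∃ w ∈ P, ∃ b ∈ B, x ∈ bidCell P B β w b
  · obtain ⟨w, hw, b, hb, hx⟩ := h
    rwa [spread_eq hβ hw hb hx]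
  · push Not at h
    have : spread P B β x = 0 := Finset.sum_eq_zero fun w hw => Finset.sum_eq_zero fun b hb =>
      Set.indicator_of_notMem (h w hw b hb) _
    rwa [this]

lemma measurable_spread : Measurable (spread P B β) := by
  unfold spread
  exact Finset.measurable_sum _ fun w _ => Finset.measurable_sum _ fun b _ =>
    measurable_const.indicator measurableSet_Ico

/-- At every value in `[0,1]` the spread strategy plays a bid that the mixed strategy
supports at the left endpoint of the cell containing that value. -/
lemma exists_spread_eq (h0 : (0 : ℝ) ∈ P) (h1 : (1 : ℝ) ∈ P) (hβ : ∀ v ∈ P, IsDist B (β v))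
    {x : ℝ} (hx : x ∈ Set.Icc (0 : ℝ) 1) :
    ∃ w ∈ P, w ≤ x ∧ (∀ s ∈ P, s ≤ x → s ≤ w) ∧ spread P B β x ∈ B ∧
      x ∈ bidCell P B β w (spread P B β x) := by
  obtain ⟨w, hw, hxw, hmax⟩ := exists_mem_cell h0 h1 hx
  obtain ⟨b, hb, hxb⟩ := exists_mem_bidCell (hβ w hw) hxw
  have := spread_eq hβ hw hb hxb
  exact ⟨w, hw, hxw.1, hmax, by rwa [this], by rwa [this]⟩

lemma spread_monotoneOn (h0 : (0 : ℝ) ∈ P) (h1 : (1 : ℝ) ∈ P)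
    (hβ : ∀ v ∈ P, IsDist B (β v)) (hm : MonotoneStrat P B β) :
    MonotoneOn (spread P B β) (Set.Icc 0 1) := by
  intro x hx y hy hxy
  obtain ⟨w, hw, hwx, -, hxB, hxc⟩ := exists_spread_eq h0 h1 hβ hx
  obtain ⟨w', hw', -, hmax, hyB, hyc⟩ := exists_spread_eq h0 h1 hβ hy
  rcases (hmax w hw (hwx.trans hxy)).lt_or_eq with h | rfl
  · exact hm w hw w' hw' h _ hxB _ hyB (pos_of_mem_bidCell hxc) (pos_of_mem_bidCell hyc)
  · exact bid_le_of_mem_bidCell (hβ w hw) hyB hxc hyc hxy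

lemma integral_spread_preimage {S : Finset ℝ} (h0 : (0 : ℝ) ∈ P) (h1 : (1 : ℝ) ∈ P)
    (hP : ∀ x ∈ P, x ∈ Set.Icc (0 : ℝ) 1) (hSP : ∀ s ∈ S, s ∈ Set.Icc (0 : ℝ) 1 → s ∈ P)
    {ρ : ℝ → ℝ} (h : IsPCDensity ρ) (hS : ConstOff S ρ) (hβ : ∀ v ∈ P, IsDist B (β v))
    {b : ℝ} (hb : b ∈ B) :
    ∫ x in spread P B β ⁻¹' {b}, ρ x = ∑ w ∈ P, cellMass P ρ w * β w b := by
  rw [integral_inter_cell_sum h0 h1 h (measurable_spread (measurableSet_singleton b))]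
  refine Finset.sum_congr rfl fun w hw => ?_
  have hset : spread P B β ⁻¹' {b} ∩ cell P w = bidCell P B β w b := by
    ext x
    refine ⟨fun ⟨hxb, hxw⟩ => ?_, fun hx => ⟨spread_eq hβ hw hb hx,
      bidCell_subset_cell (hβ w hw) hb hx⟩⟩
    obtain ⟨b', hb', hx⟩ := exists_mem_bidCell (hβ w hw) hxw
    have := spread_eq hβ hw hb' hx
    rw [Set.mem_preimage, Set.mem_singleton_iff, this] at hxb
    rwa [← hxb]
  obtain ⟨c, hc⟩ := exists_const_on_cell h1 hP hSP h hS hw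
  have hL : 0 < nextPoint P w - w := sub_pos.2 (lt_nextPoint P w)
  have hs : 0 ≤ ∑ a ∈ B with a < b, β w a := Finset.sum_nonneg fun _ _ => (hβ w hw).1 _
  have hone := sum_lt_add_le_one (hβ w hw) hb
  have hpos := (hβ w hw).1 b
  rw [hset, cellMass, if_pos hw, cell, bidCell,
    integral_Ico_of_const hc le_rfl (lt_nextPoint P w).le le_rfl,
    integral_Ico_of_const hc (by nlinarith) (by nlinarith) (by nlinarith)]
  ring

end Spread

lemma exPost_sub_mem (n : ℕ) (i : Fin n) {v w : ℝ} (h : w ≤ v) (bb : Fin n → ℝ) :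
    0 ≤ exPost n i v bb - exPost n i w bb ∧ exPost n i v bb - exPost n i w bb ≤ v - w := by
  unfold exPost
  split_ifs with hi
  · have hc : 1 ≤ ((Finset.univ.filter (fun j : Fin n => ∀ k, bb k ≤ bb j)).card : ℝ) := by
      exact_mod_cast Finset.card_pos.2 ⟨i, by simpa using hi⟩
    rw [← sub_div, sub_sub_sub_cancel_right]
    exact ⟨div_nonneg (by linarith) (by linarith), div_le_self (by linarith) hc⟩
  · constructor <;> linarith

lemma interim_sub_mem (n : ℕ) {V : Fin n → Finset ℝ} {B : Finset ℝ}
    {f : Fin n → Fin n → ℝ → ℝ} {β : Fin n → ℝ → ℝ → ℝ} (hf : IsPrior n V f)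
    (hβ : IsMixedProfile n V B β) (i : Fin n) (b : ℝ) {v w : ℝ} (h : w ≤ v) :
    0 ≤ interim n V B f β i b v - interim n V B f β i b w ∧
      interim n V B f β i b v - interim n V B f β i b w ≤ v - w := by
  have hp : ∀ bb : Fin n → ℝ,
      0 ≤ ∏ j ∈ Finset.univ.erase i, ∑ u ∈ V j, f i j u * β j u (bb j) := fun bb =>
    Finset.prod_nonneg fun j hj => Finset.sum_nonneg fun u hu =>
      mul_nonneg ((hf i j (Finset.ne_of_mem_erase hj).symm).1 u) ((hβ j u hu).1 _)
  have hsum : ∑ bb ∈ Fintype.piFinset (fun j : Fin n => if j = i then ({b} : Finset ℝ) else B),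
      ∏ j ∈ Finset.univ.erase i, ∑ u ∈ V j, f i j u * β j u (bb j) = 1 := by
    have hprod : ∀ bb : Fin n → ℝ,
        ∏ j ∈ Finset.univ.erase i, ∑ u ∈ V j, f i j u * β j u (bb j) =
          ∏ j, if j = i then 1 else ∑ u ∈ V j, f i j u * β j u (bb j) := fun bb => by
      rw [← Finset.prod_erase (a := i) Finset.univ (by simp)]
      exact Finset.prod_congr rfl fun j hj => by simp [Finset.ne_of_mem_erase hj]
    simp_rw [hprod]
    rw [← Finset.prod_univ_sum (fun j : Fin n => if j = i then ({b} : Finset ℝ) else B)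
      (fun j a => if j = i then 1 else ∑ u ∈ V j, f i j u * β j u a)]
    refine Finset.prod_eq_one fun j _ => ?_
    by_cases hj : j = i
    · simp [hj]
    · simp only [hj, if_false]
      rw [Finset.sum_comm, ← (hf i j (Ne.symm hj)).2.2]
      refine Finset.sum_congr rfl fun u hu => ?_
      rw [← Finset.mul_sum, (hβ j u hu).2, mul_one]
  unfold interim
  rw [← Finset.sum_sub_distrib]
  simp_rw [← mul_sub]
  refine ⟨Finset.sum_nonneg fun bb _ => mul_nonneg (hp bb) (exPost_sub_mem n i h bb).1, ?_⟩
  rw [← one_mul (v - w), ← hsum, Finset.sum_mul]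
  exact Finset.sum_le_sum fun bb _ =>
    mul_le_mul_of_nonneg_left (exPost_sub_mem n i h bb).2 (hp bb)

lemma integral_pi_exPost (n : ℕ) {B : Finset ℝ} {β : Fin n → ℝ → ℝ}
    (hB : ∀ j x, β j x ∈ B) (hm : ∀ j, Measurable (β j)) (μ : Fin n → Measure ℝ)
    [∀ j, IsProbabilityMeasure (μ j)] (i : Fin n) (b v : ℝ) :
    ∫ vv, exPost n i v (Function.update (fun j => β j (vv j)) i b) ∂(Measure.pi μ) =
      ∑ bb ∈ Fintype.piFinset (fun j : Fin n => if j = i then ({b} : Finset ℝ) else B),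
        (∏ j ∈ Finset.univ.erase i, (μ j).real (β j ⁻¹' {bb j})) * exPost n i v bb := by
  set G : (Fin n → ℝ) → Fin n → ℝ → ℝ := fun bb j =>
    if j = i then 1 else (β j ⁻¹' {bb j}).indicator 1 with hG
  have hGint : ∀ bb j, Integrable (G bb j) (μ j) := by
    intro bb j
    by_cases hj : j = i
    · simp only [hG, hj, if_true]
      exact integrable_const 1
    · simp only [hG, hj, if_false]
      exact (integrable_const 1).indicator (hm j (measurableSet_singleton _))
  have hpt : ∀ vv : Fin n → ℝ, exPost n i v (Function.update (fun j => β j (vv j)) i b) =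
      ∑ bb ∈ Fintype.piFinset (fun j : Fin n => if j = i then ({b} : Finset ℝ) else B),
        (∏ j, G bb j (vv j)) * exPost n i v bb := by
    intro vv
    rw [Finset.sum_eq_single_of_mem (Function.update (fun j => β j (vv j)) i b)]
    · rw [Finset.prod_eq_one, one_mul]
      intro j _
      by_cases hj : j = i <;> simp [hG, hj]
    · rw [Fintype.mem_piFinset]
      intro j
      by_cases hj : j = i
      · subst hj
        simp
      · simp [hj, hB]
    · intro bb hbb hne
      obtain ⟨j, hj⟩ := Function.ne_iff.1 hne
      have hbj := Fintype.mem_piFinset.1 hbb j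
      have hji : j ≠ i := by
        rintro rfl
        simp at hbj
        simp [hbj] at hj
      rw [Finset.prod_eq_zero (Finset.mem_univ j), zero_mul]
      rw [Function.update_of_ne hji] at hj
      simp [hG, hji, Ne.symm hj]
  simp_rw [hpt]
  rw [integral_finsetSum _ fun bb _ => (Integrable.fintype_prod (hGint bb)).mul_const _]
  refine Finset.sum_congr rfl fun bb _ => ?_
  rw [integral_mul_const, integral_fintype_prod_eq_prod,
    ← Finset.prod_erase (a := i) Finset.univ (by simp [hG])]
  congr 1
  refine Finset.prod_congr rfl fun j hj => ?_
  simp only [hG, Finset.ne_of_mem_erase hj, if_false]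
  exact integral_indicator_one (hm j (measurableSet_singleton _))

lemma IsPCDensity.withDensity_real {ρ : ℝ → ℝ} (h : IsPCDensity ρ) {A : Set ℝ}
    (hA : MeasurableSet A) :
    (volume.withDensity fun x => ENNReal.ofReal (ρ x)).real A = ∫ x in A, ρ x := by
  rw [Measure.real, withDensity_apply _ hA,
    ← ofReal_integral_eq_lintegral_ofReal h.integrable.integrableOn
      (Filter.Eventually.of_forall h.1),
    ENNReal.toReal_ofReal (integral_nonneg h.1)]

lemma IsPCDensity.isProbabilityMeasure {ρ : ℝ → ℝ} (h : IsPCDensity ρ) :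
    IsProbabilityMeasure (volume.withDensity fun x => ENNReal.ofReal (ρ x)) := by
  constructor
  rw [withDensity_apply _ MeasurableSet.univ, Measure.restrict_univ,
    ← ofReal_integral_eq_lintegral_ofReal h.integrable (Filter.Eventually.of_forall h.1),
    h.2.2.1, ENNReal.ofReal_one]

lemma cInterim_spread (n : ℕ) {P B S : Finset ℝ} (h0 : (0 : ℝ) ∈ P) (h1 : (1 : ℝ) ∈ P)
    (hP : ∀ x ∈ P, x ∈ Set.Icc (0 : ℝ) 1) (hSP : ∀ s ∈ S, s ∈ Set.Icc (0 : ℝ) 1 → s ∈ P)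
    (h0B : (0 : ℝ) ∈ B) {ρ : Fin n → Fin n → ℝ → ℝ}
    (hρ : ∀ i j : Fin n, i ≠ j → IsPCDensity (ρ i j))
    (hS : ∀ i j : Fin n, i ≠ j → ConstOff S (ρ i j))
    {β : Fin n → ℝ → ℝ → ℝ} (hβ : IsMixedProfile n (fun _ => P) B β) (i : Fin n) (b : ℝ)
    (v : ℝ) :
    cInterim n ρ (fun j => spread P B (β j)) i b v =
      interim n (fun _ => P) B (fun i j => cellMass P (ρ i j)) β i b v := by
  have : ∀ j : Fin n, IsProbabilityMeasure (if j = i then Measure.dirac (0 : ℝ)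
      else volume.withDensity (fun x => ENNReal.ofReal (ρ i j x))) := by
    intro j
    split_ifs with hj
    · infer_instance
    · exact (hρ i j (Ne.symm hj)).isProbabilityMeasure
  rw [cInterim, integral_pi_exPost n (fun j => spread_mem h0B (hβ j))
    (fun j => measurable_spread)]
  refine Finset.sum_congr rfl fun bb hbb => ?_
  congr 1
  refine Finset.prod_congr rfl fun j hj => ?_
  have hji := Finset.ne_of_mem_erase hj
  have hbj := Fintype.mem_piFinset.1 hbb j
  rw [if_neg hji] at hbj ⊢
  rw [(hρ i j hji.symm).withDensity_real (measurable_spread (measurableSet_singleton _))]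
  exact integral_spread_preimage h0 h1 hP hSP (hρ i j hji.symm) (hS i j hji.symm) (hβ j) hbj

lemma WSMBNE.interim_le {n : ℕ} {V : Fin n → Finset ℝ} {B : Finset ℝ}
    {f : Fin n → Fin n → ℝ → ℝ} {β : Fin n → ℝ → ℝ → ℝ} {ε : ℝ} (h : WSMBNE n V B f β ε)
    {i : Fin n} {v b b' : ℝ} (hv : v ∈ V i) (hb : b ∈ B) (hpos : 0 < β i v b) (hb' : b' ∈ B) :
    interim n V B f β i b' v - ε ≤ interim n V B f β i b v := by
  have := h i v hv b hb hpos (fun a => if a = b' then 1 else 0)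
    ⟨fun a => by positivity, by simp [hb']⟩
  simpa [interimMix, hb'] using this

lemma ConstOff.mono {S T : Finset ℝ} {ρ : ℝ → ℝ} (h : ConstOff S ρ) (hST : S ⊆ T) :
    ConstOff T ρ := fun x y hx hy hs =>
  h x y (fun h => hx (hST h)) (fun h => hy (hST h)) fun s hsS => hs s (hST hsS)

lemma exists_common_breakpoints {n : ℕ} {ρ : Fin n → Fin n → ℝ → ℝ}
    (hρ : ∀ i j : Fin n, i ≠ j → IsPCDensity (ρ i j)) :
    ∃ S : Finset ℝ, ∀ i j : Fin n, i ≠ j → ConstOff S (ρ i j) := by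
  have : ∀ i j : Fin n, ∃ S : Finset ℝ, i ≠ j → ConstOff S (ρ i j) := by
    intro i j
    by_cases hij : i = j
    · exact ⟨∅, fun h => absurd hij h⟩
    · obtain ⟨S, hS⟩ := (hρ i j hij).2.2.2
      exact ⟨S, fun _ => hS⟩
  choose S hS using this
  refine ⟨Finset.univ.biUnion fun i => Finset.univ.biUnion (S i), fun i j hij =>
    (hS i j hij).mono fun s hs => ?_⟩
  simp only [Finset.mem_biUnion, Finset.mem_univ, true_and]
  exact ⟨i, j, hs⟩

/-- Every finite set of breakpoints extends to a partition of `[0,1]` of mesh at most `δ`. -/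
lemma exists_fine_partition {δ : ℝ} (hδ : 0 < δ) (S : Finset ℝ) :
    ∃ P : Finset ℝ, 0 ∈ P ∧ 1 ∈ P ∧ (∀ x ∈ P, x ∈ Set.Icc (0 : ℝ) 1) ∧
      (∀ s ∈ S, s ∈ Set.Icc (0 : ℝ) 1 → s ∈ P) ∧
      ∀ x ∈ Set.Icc (0 : ℝ) 1, ∃ s ∈ P, s ≤ x ∧ x - s ≤ δ := by
  classical
  obtain ⟨M, hM⟩ := exists_nat_one_div_lt hδ
  have hM0 : (0 : ℝ) < M + 1 := by positivity
  refine ⟨(Finset.range (M + 2)).image (fun k : ℕ => (k : ℝ) / (M + 1)) ∪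
    S.filter (· ∈ Set.Icc (0 : ℝ) 1), ?_, ?_, ?_, ?_, ?_⟩
  · exact Finset.mem_union_left _ (Finset.mem_image.2 ⟨0, by simp, by simp⟩)
  · exact Finset.mem_union_left _
      (Finset.mem_image.2 ⟨M + 1, by simp, by push_cast; exact div_self hM0.ne'⟩)
  · intro x hx
    rcases Finset.mem_union.1 hx with h | h
    · obtain ⟨k, hk, rfl⟩ := Finset.mem_image.1 h
      have : (k : ℝ) ≤ M + 1 := by exact_mod_cast Nat.lt_succ_iff.1 (Finset.mem_range.1 hk)
      exact ⟨by positivity, (div_le_one hM0).2 this⟩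
    · exact (Finset.mem_filter.1 h).2
  · exact fun s hs hs' => Finset.mem_union_right _ (Finset.mem_filter.2 ⟨hs, hs'⟩)
  · intro x hx
    have hfl := Nat.floor_le (mul_nonneg hx.1 hM0.le)
    have hlt := Nat.lt_floor_add_one (x * (M + 1))
    refine ⟨(⌊x * (M + 1)⌋₊ : ℝ) / (M + 1), Finset.mem_union_left _
      (Finset.mem_image.2 ⟨_, ?_, rfl⟩), (div_le_iff₀ hM0).2 hfl, ?_⟩
    · rw [Finset.mem_range, Nat.lt_succ_iff]
      refine Nat.floor_le_of_le ?_
      push_cast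
      nlinarith [hx.2]
    · refine le_trans ?_ hM.le
      rw [le_div_iff₀ hM0, sub_mul, div_mul_cancel₀ _ hM0.ne']
      linarith

/-- For every `δ ∈ (0,1)` and every CFPA with piecewise-constant-
density priors there is a DFPA (same bidders, same bidding space) such that every
monotone, non-overbidding ε-well-supported MBNE of the DFPA yields an
`(ε+δ)`-approximate pure BNE of the CFPA; moreover the DFPA is iid whenever the CFPA
is, and the continuous equilibrium can be chosen symmetric whenever the discrete one
is symmetric. -/
theorem stmt5 (δ : ℝ) (hδ0 : 0 < δ) (hδ1 : δ < 1)
    (n : ℕ) (hn : 2 ≤ n) (B : Finset ℝ)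
    (hB : ↑B ⊆ Set.Icc (0:ℝ) 1) (h0B : (0:ℝ) ∈ B)
    (ρ : Fin n → Fin n → ℝ → ℝ) (hρ : ∀ i j : Fin n, i ≠ j → IsPCDensity (ρ i j)) :
    ∃ (V : Fin n → Finset ℝ) (f : Fin n → Fin n → ℝ → ℝ),
      (∀ i, ↑(V i) ⊆ Set.Icc (0:ℝ) 1) ∧
      IsPrior n V f ∧
      ((∃ ρ0 : ℝ → ℝ, ∀ i j : Fin n, i ≠ j → ρ i j = ρ0) →
        ∃ (V0 : Finset ℝ) (f0 : ℝ → ℝ), (∀ i, V i = V0) ∧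
          ∀ i j : Fin n, i ≠ j → f i j = f0) ∧
      (∀ ε : ℝ, 0 ≤ ε → ∀ β : Fin n → ℝ → ℝ → ℝ,
        IsMixedProfile n V B β → NonOverbidding n V B β →
        (∀ i : Fin n, MonotoneStrat (V i) B (β i)) →
        WSMBNE n V B f β ε →
        ∃ β' : Fin n → ℝ → ℝ,
          CPureProfile n B β' ∧
          CPBNE n B ρ β' (ε + δ) ∧
          ((∀ i i' : Fin n, β i = β i') → ∀ i i' : Fin n, β' i = β' i')) := by
  obtain ⟨S, hS⟩ := exists_common_breakpoints hρ
  obtain ⟨P, h0, h1, hP, hSP, hmesh⟩ := exists_fine_partition hδ0 S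
  have hprior : IsPrior n (fun _ => P) (fun i j => cellMass P (ρ i j)) := fun i j hij =>
    isPCDensity_cellMass h0 h1 (hρ i j hij)
  refine ⟨fun _ => P, fun i j => cellMass P (ρ i j), fun _ => hP, hprior, ?_, ?_⟩
  · rintro ⟨ρ0, hρ0⟩
    exact ⟨P, cellMass P ρ0, fun _ => rfl, fun i j hij => by simp only [hρ0 i j hij]⟩
  intro ε _ β hβ hno hmono heq
  refine ⟨fun i => spread P B (β i), fun i => ⟨spread_monotoneOn h0 h1 (hβ i) (hmono i), ?_⟩,
    ?_, fun h i i' => by simp only [h i i']⟩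
  · intro v hv
    obtain ⟨w, hw, hwv, -, hB', hvc⟩ := exists_spread_eq h0 h1 (hβ i) hv
    refine ⟨hB', le_trans ?_ hwv⟩
    by_contra! hlt
    exact (pos_of_mem_bidCell hvc).ne' (hno i w hw _ hB' hlt)
  · intro i v hv b hb
    obtain ⟨w, hw, hwv, hmax, hB', hvc⟩ := exists_spread_eq h0 h1 (hβ i) hv
    obtain ⟨s, hs, hsv, hδs⟩ := hmesh v hv
    rw [cInterim_spread n h0 h1 hP hSP h0B hρ hS hβ, cInterim_spread n h0 h1 hP hSP h0B hρ hS hβ]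
    have hbest := heq.interim_le hw hB' (pos_of_mem_bidCell hvc) hb
    have hplay := (interim_sub_mem n hprior hβ i (spread P B (β i) v) hwv).1
    have hdev := (interim_sub_mem n hprior hβ i b hwv).2
    linarith [hmax s hs hsv]
end

section
/- Let a discrete first-price auction have interaction degree bounded by d ∈ {1,…,n−1} and let ε ∈ [0,1]. For every non-overbidding (ε²/(8d))-approximate mixed Bayes–Nash equilibrium β there exists a non-overbidding ε-well-supported mixed Bayes–Nash equilibrium β' such that supp β'_i(v) ⊆ supp β_i(v) for every bidder i and every v ∈ V_i; consequently β' is monotone whenever β is monotone, and if the auction is iid and β is symmetric then β' can be chosen symmetric. -/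
open Finset

/-- Two product weights that both dominate a nonnegative product weight `∏ r` assign to a
`[0,1]`-valued function expectations differing by at most the total mass missing from `r`. -/
theorem sum_prod_mul_sub_le {ι : Type*} [Fintype ι] [DecidableEq ι] (s : ι → Finset ℝ)
    (p q r : ι → ℝ → ℝ) (g : (ι → ℝ) → ℝ)
    (hr : ∀ j, ∀ x ∈ s j, 0 ≤ r j x) (hrp : ∀ j, ∀ x ∈ s j, r j x ≤ p j x)
    (hrq : ∀ j, ∀ x ∈ s j, r j x ≤ q j x) (hp : ∀ j, ∑ x ∈ s j, p j x = 1)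
    (hg0 : ∀ a, 0 ≤ g a) (hg1 : ∀ a, g a ≤ 1) :
    ∑ a ∈ Fintype.piFinset s, (∏ j, p j (a j)) * g a
      - ∑ a ∈ Fintype.piFinset s, (∏ j, q j (a j)) * g a
      ≤ ∑ j, (1 - ∑ x ∈ s j, r j x) := by
  have hle : ∀ t : ι → ℝ → ℝ, (∀ j, ∀ x ∈ s j, r j x ≤ t j x) →
      ∀ a ∈ Fintype.piFinset s, ∏ j, r j (a j) ≤ ∏ j, t j (a j) := by
    intro t ht a ha
    rw [Fintype.mem_piFinset] at ha
    exact Finset.prod_le_prod (fun j _ => hr j _ (ha j)) (fun j _ => ht j _ (ha j))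
  have hq : ∑ a ∈ Fintype.piFinset s, (∏ j, r j (a j)) * g a
      ≤ ∑ a ∈ Fintype.piFinset s, (∏ j, q j (a j)) * g a :=
    Finset.sum_le_sum fun a ha => mul_le_mul_of_nonneg_right (hle q hrq a ha) (hg0 a)
  have hpr : ∑ a ∈ Fintype.piFinset s, (∏ j, p j (a j)) * g a
      - ∑ a ∈ Fintype.piFinset s, (∏ j, r j (a j)) * g a
      ≤ ∑ a ∈ Fintype.piFinset s, (∏ j, p j (a j)) - ∑ a ∈ Fintype.piFinset s, ∏ j, r j (a j) := by
    rw [← Finset.sum_sub_distrib, ← Finset.sum_sub_distrib]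
    refine Finset.sum_le_sum fun a ha => ?_
    rw [← sub_mul]
    exact mul_le_of_le_one_right (sub_nonneg.2 (hle p hrp a ha)) (hg1 a)
  rw [← Finset.prod_univ_sum, ← Finset.prod_univ_sum, Finset.prod_congr rfl fun j _ => hp j,
    Finset.prod_const_one] at hpr
  have hm0 : ∀ j, 0 ≤ ∑ x ∈ s j, r j x := fun j => Finset.sum_nonneg (hr j)
  have hm1 : ∀ j, ∑ x ∈ s j, r j x ≤ 1 := fun j => hp j ▸ Finset.sum_le_sum (hrp j)
  have hB : ∀ u : Finset ι, 1 - ∑ j ∈ u, (1 - ∑ x ∈ s j, r j x) ≤ ∏ j ∈ u, ∑ x ∈ s j, r j x ∧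
      ∏ j ∈ u, ∑ x ∈ s j, r j x ≤ 1 := by
    intro u
    refine ⟨?_, Finset.prod_le_one (fun j _ => hm0 j) fun j _ => hm1 j⟩
    induction u using Finset.induction_on with
    | empty => simp
    | insert k u hk ih =>
      rw [Finset.sum_insert hk, Finset.prod_insert hk]
      have h1 := Finset.prod_le_one (s := u) (fun j _ => hm0 j) fun j _ => hm1 j
      nlinarith [hm0 k, hm1 k]
  linarith [(hB Finset.univ).1]

/-- The probability with which bidder `i` wins under the bid profile `bb`. -/
noncomputable def winShare (n : ℕ) (i : Fin n) (bb : Fin n → ℝ) : ℝ :=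
  if ∀ k, bb k ≤ bb i then
    1 / ((Finset.univ.filter (fun j : Fin n => ∀ k, bb k ≤ bb j)).card : ℝ)
  else 0

theorem exPost_eq_mul_winShare (n : ℕ) (i : Fin n) (v : ℝ) (bb : Fin n → ℝ) :
    exPost n i v bb = (v - bb i) * winShare n i bb := by
  unfold exPost winShare
  split_ifs <;> ring

theorem winShare_nonneg (n : ℕ) (i : Fin n) (bb : Fin n → ℝ) : 0 ≤ winShare n i bb := by
  unfold winShare
  split_ifs <;> positivity

theorem winShare_le_one (n : ℕ) (i : Fin n) (bb : Fin n → ℝ) : winShare n i bb ≤ 1 := by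
  unfold winShare
  split_ifs with h
  · refine div_le_one_of_le₀ ?_ (Nat.cast_nonneg _)
    exact_mod_cast Finset.card_pos.2 ⟨i, by simpa using h⟩
  · exact zero_le_one

/-- The interim distribution of opponent `j`'s bid, with value `1` at bidder `i` itself. -/
noncomputable def oppBid (n : ℕ) (V : Fin n → Finset ℝ) (f : Fin n → Fin n → ℝ → ℝ)
    (β : Fin n → ℝ → ℝ → ℝ) (i j : Fin n) (x : ℝ) : ℝ :=
  if j = i then 1 else ∑ w ∈ V j, f i j w * β j w x

theorem interim_eq (n : ℕ) (V : Fin n → Finset ℝ) (B : Finset ℝ)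
    (f : Fin n → Fin n → ℝ → ℝ) (β : Fin n → ℝ → ℝ → ℝ) (i : Fin n) (b v : ℝ) :
    interim n V B f β i b v = (v - b) *
      ∑ bb ∈ Fintype.piFinset (fun j : Fin n => if j = i then ({b} : Finset ℝ) else B),
        (∏ j, oppBid n V f β i j (bb j)) * winShare n i bb := by
  unfold interim
  rw [Finset.mul_sum]
  refine Finset.sum_congr rfl fun bb hbb => ?_
  have hi : bb i = b := by simpa using Fintype.mem_piFinset.1 hbb i
  rw [exPost_eq_mul_winShare, hi, ← Finset.mul_prod_erase Finset.univ _ (Finset.mem_univ i),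
    Finset.prod_congr (g := fun j => oppBid n V f β i j (bb j)) rfl]
  · simp only [oppBid, if_true]
    ring
  · intro j hj
    simp [oppBid, Finset.ne_of_mem_erase hj]

theorem sum_oppBid (n : ℕ) (V : Fin n → Finset ℝ) (B : Finset ℝ)
    (f : Fin n → Fin n → ℝ → ℝ) (ρ : Fin n → ℝ → ℝ → ℝ) (i j : Fin n) (b : ℝ) :
    ∑ x ∈ (if j = i then ({b} : Finset ℝ) else B), oppBid n V f ρ i j x
      = if j = i then 1 else ∑ w ∈ V j, f i j w * ∑ x ∈ B, ρ j w x := by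
  by_cases h : j = i
  · simp [h, oppBid]
  · simp only [h, if_false, oppBid]
    rw [Finset.sum_comm]
    simp only [Finset.mul_sum]

theorem oppBid_mono (n : ℕ) (V : Fin n → Finset ℝ) (f : Fin n → Fin n → ℝ → ℝ)
    (hf : IsPrior n V f) (ρ β : Fin n → ℝ → ℝ → ℝ)
    (h : ∀ j, ∀ w ∈ V j, ∀ x, ρ j w x ≤ β j w x) (i j : Fin n) (x : ℝ) :
    oppBid n V f ρ i j x ≤ oppBid n V f β i j x := by
  unfold oppBid
  split_ifs with hj
  · exact le_rfl
  · exact Finset.sum_le_sum fun w hw =>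
      mul_le_mul_of_nonneg_left (h j w hw x) ((hf i j (Ne.symm hj)).1 w)

theorem oppBid_nonneg (n : ℕ) (V : Fin n → Finset ℝ) (f : Fin n → Fin n → ℝ → ℝ)
    (hf : IsPrior n V f) (ρ : Fin n → ℝ → ℝ → ℝ)
    (h : ∀ j, ∀ w ∈ V j, ∀ x, 0 ≤ ρ j w x) (i j : Fin n) (x : ℝ) :
    0 ≤ oppBid n V f ρ i j x := by
  unfold oppBid
  split_ifs with hj
  · exact zero_le_one
  · exact Finset.sum_nonneg fun w hw =>
      mul_nonneg ((hf i j (Ne.symm hj)).1 w) (h j w hw x)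

/-- If `β` and `β'` both dominate the sub-distributions `ρ`, interim utilities under `β` and `β'`
differ by at most the total opponent mass missing from `ρ`. -/
theorem abs_interim_sub_le (n : ℕ) (V : Fin n → Finset ℝ) (B : Finset ℝ)
    (f : Fin n → Fin n → ℝ → ℝ) (hf : IsPrior n V f) (ρ β β' : Fin n → ℝ → ℝ → ℝ)
    (hβ : IsMixedProfile n V B β) (hβ' : IsMixedProfile n V B β')
    (h0 : ∀ j, ∀ w ∈ V j, ∀ x, 0 ≤ ρ j w x)
    (h : ∀ j, ∀ w ∈ V j, ∀ x, ρ j w x ≤ β j w x)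
    (h' : ∀ j, ∀ w ∈ V j, ∀ x, ρ j w x ≤ β' j w x)
    (i : Fin n) (b v : ℝ) (hbv : |v - b| ≤ 1) :
    |interim n V B f β i b v - interim n V B f β' i b v|
      ≤ ∑ j, (1 - if j = i then 1 else ∑ w ∈ V j, f i j w * ∑ x ∈ B, ρ j w x) := by
  have hsum : ∀ σ : Fin n → ℝ → ℝ → ℝ, IsMixedProfile n V B σ → ∀ j,
      ∑ x ∈ (if j = i then ({b} : Finset ℝ) else B), oppBid n V f σ i j x = 1 := by
    intro σ hσ j
    rw [sum_oppBid]
    split_ifs with hj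
    · rfl
    · rw [← (hf i j (Ne.symm hj)).2.2]
      exact Finset.sum_congr rfl fun w hw => by rw [(hσ j w hw).2, mul_one]
  have key := fun σ σ' hσ hρσ hρσ' => sum_prod_mul_sub_le
    (fun j : Fin n => if j = i then ({b} : Finset ℝ) else B)
    (oppBid n V f σ i) (oppBid n V f σ' i) (oppBid n V f ρ i) (winShare n i)
    (fun j x _ => oppBid_nonneg n V f hf ρ h0 i j x)
    (fun j x _ => oppBid_mono n V f hf ρ σ hρσ i j x)
    (fun j x _ => oppBid_mono n V f hf ρ σ' hρσ' i j x) (hsum σ hσ)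
    (winShare_nonneg n i) (winShare_le_one n i)
  have h1 := key β β' hβ h h'
  have h2 := key β' β hβ' h' h
  simp only [sum_oppBid] at h1 h2
  rw [interim_eq, interim_eq, ← mul_sub, abs_mul]
  refine (mul_le_of_le_one_left (abs_nonneg _) hbv).trans ?_
  exact abs_sub_le_iff.2 ⟨h1, h2⟩

theorem interim_eq_of_symmetric (n : ℕ) (V : Fin n → Finset ℝ) (B : Finset ℝ)
    (f : Fin n → Fin n → ℝ → ℝ) (β : Fin n → ℝ → ℝ → ℝ) (V0 : Finset ℝ) (f0 : ℝ → ℝ)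
    (hV : ∀ i, V i = V0) (hf : ∀ i j : Fin n, i ≠ j → f i j = f0)
    (hβ : ∀ i i' : Fin n, β i = β i') (i i' : Fin n) (b v : ℝ) :
    interim n V B f β i b v = interim n V B f β i' b v := by
  rw [interim_eq, interim_eq]
  congr 1
  have hiff : ∀ j, Equiv.swap i i' j = i ↔ j = i' := fun j => by
    rw [Equiv.swap_apply_eq_iff, Equiv.swap_apply_left]
  have hopp : ∀ j x, oppBid n V f β i (Equiv.swap i i' j) x = oppBid n V f β i' j x := by
    intro j x
    by_cases hj : j = i'
    · simp [oppBid, hj]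
    · have hj' : Equiv.swap i i' j ≠ i := fun h => hj ((hiff j).1 h)
      simp only [oppBid, hj, hj', if_false]
      rw [hV, hV, hf _ _ hj'.symm, hf _ _ (Ne.symm hj), hβ (Equiv.swap i i' j) j]
  have hwin : ∀ bb : Fin n → ℝ, winShare n i' (fun j => bb (Equiv.swap i i' j))
      = winShare n i bb := by
    intro bb
    have hall : ∀ c : ℝ, (∀ k, bb (Equiv.swap i i' k) ≤ c) ↔ ∀ k, bb k ≤ c := fun c =>
      (Equiv.swap i i').forall_congr_right (q := fun k => bb k ≤ c)
    unfold winShare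
    simp only [hall, Equiv.swap_apply_right]
    congr 3
    refine Finset.card_equiv (Equiv.swap i i') fun j => ?_
    simp
  refine Finset.sum_equiv ((Equiv.swap i i').arrowCongr (Equiv.refl ℝ)) ?_ ?_
  · intro bb
    simp only [Fintype.mem_piFinset, Equiv.arrowCongr_apply, Equiv.symm_swap, Function.comp_apply,
      Equiv.coe_refl, id_eq]
    rw [← (Equiv.swap i i').forall_congr_right]
    refine forall_congr' fun j => ?_
    simp only [hiff]
  · intro bb _
    simp only [Equiv.arrowCongr_apply, Equiv.symm_swap, Equiv.coe_refl]
    change _ = (∏ j, oppBid n V f β i' j (bb (Equiv.swap i i' j))) *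
      winShare n i' (fun j => bb (Equiv.swap i i' j))
    rw [hwin, ← Equiv.prod_comp (Equiv.swap i i')]
    simp only [hopp]

/-- The bids of `B` whose utility is within `t` of that of every bid in `B`. -/
noncomputable def nearBest (B : Finset ℝ) (u : ℝ → ℝ) (t : ℝ) : Finset ℝ :=
  open scoped Classical in B.filter fun b => ∀ c ∈ B, u c ≤ u b + t

/-- If the mean of `u` under `γ` is within `ε²/(8d)` of the best, `γ` puts mass at least
`1 - ε/(4d)` on bids that are within `ε/2` of the best. -/
theorem one_sub_le_sum_nearBest (B : Finset ℝ) (u γ : ℝ → ℝ) (hγ : IsDist B γ)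
    (d : ℕ) (ε : ℝ) (hε0 : 0 ≤ ε)
    (h : ∀ γ' : ℝ → ℝ, IsDist B γ' →
      ∑ b ∈ B, γ b * u b ≥ ∑ b ∈ B, γ' b * u b - ε ^ 2 / (8 * (d : ℝ))) :
    1 - ε / (4 * d) ≤ ∑ b ∈ nearBest B u (ε / 2), γ b := by
  classical
  have hne : B.Nonempty := by
    rw [Finset.nonempty_iff_ne_empty]
    rintro rfl
    simpa using hγ.2
  obtain ⟨c, hc, hmax⟩ := B.exists_max_image u hne
  have hδ : ∑ b ∈ B, γ b * (u c - u b) ≤ ε ^ 2 / (8 * (d : ℝ)) := by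
    have := h (fun b => if b = c then 1 else 0)
      ⟨fun b => by positivity, by simp [hc]⟩
    simp only [ite_mul, one_mul, zero_mul, Finset.sum_ite_eq', hc, if_true] at this
    simp only [mul_sub, Finset.sum_sub_distrib, ← Finset.sum_mul, hγ.2]
    linarith
  have hsplit := Finset.sum_filter_add_sum_filter_not B (fun b => ∀ c ∈ B, u c ≤ u b + ε / 2) γ
  rw [hγ.2] at hsplit
  have hnear : nearBest B u (ε / 2) = B.filter fun b => ∀ c ∈ B, u c ≤ u b + ε / 2 := by
    unfold nearBest
    congr
  rw [hnear]
  set bad := B.filter fun b => ¬ ∀ c ∈ B, u c ≤ u b + ε / 2 with hbad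
  have hgap : ∀ b ∈ bad, b ∈ B ∧ ε / 2 < u c - u b := by
    intro b hb
    obtain ⟨hb, hb'⟩ := Finset.mem_filter.1 hb
    push Not at hb'
    obtain ⟨c', hc', hlt⟩ := hb'
    exact ⟨hb, by linarith [hmax c' hc']⟩
  have hterm : ∀ b ∈ B, 0 ≤ γ b * (u c - u b) := fun b hb =>
    mul_nonneg (hγ.1 b) (sub_nonneg.2 (hmax b hb))
  have hbadle : ∑ b ∈ bad, γ b ≤ ε / (4 * d) := by
    rcases hε0.eq_or_lt with rfl | hε
    · have hz : ∑ b ∈ B, γ b * (u c - u b) = 0 :=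
        le_antisymm (by simpa using hδ) (Finset.sum_nonneg hterm)
      rw [Finset.sum_eq_zero_iff_of_nonneg hterm] at hz
      rw [Finset.sum_eq_zero, zero_div]
      intro b hb
      obtain ⟨hbB, hlt⟩ := hgap b hb
      rcases mul_eq_zero.1 (hz b hbB) with h0 | h0
      · exact h0
      · linarith
    · have h1 : (∑ b ∈ bad, γ b) * (ε / 2) ≤ ∑ b ∈ bad, γ b * (u c - u b) := by
        rw [Finset.sum_mul]
        exact Finset.sum_le_sum fun b hb =>
          mul_le_mul_of_nonneg_left (hgap b hb).2.le (hγ.1 b)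
      have h2 : ∑ b ∈ bad, γ b * (u c - u b) ≤ ∑ b ∈ B, γ b * (u c - u b) :=
        Finset.sum_le_sum_of_subset_of_nonneg (Finset.filter_subset _ _)
          fun b hb _ => hterm b hb
      have h3 : ε ^ 2 / (8 * (d : ℝ)) = ε / (4 * d) * (ε / 2) := by
        rw [div_mul_div_comm]
        congr 1 <;> ring
      exact le_of_mul_le_mul_right (by linarith) (half_pos hε)
  linarith

/-- The restriction of `γ` to the bids within `t` of the best, without renormalization. -/
noncomputable def truncated (B : Finset ℝ) (u : ℝ → ℝ) (t : ℝ) (γ : ℝ → ℝ) (b : ℝ) : ℝ :=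
  if b ∈ nearBest B u t then γ b else 0

theorem sum_truncated (B : Finset ℝ) (u : ℝ → ℝ) (t : ℝ) (γ : ℝ → ℝ) :
    ∑ b ∈ B, truncated B u t γ b = ∑ b ∈ nearBest B u t, γ b := by
  unfold truncated
  rw [← Finset.sum_filter]
  congr 1
  ext b
  simp only [nearBest, Finset.mem_filter]
  tauto

/-- The mixed bid `γ` conditioned on the bids within `t` of the best. -/
noncomputable def conditioned (B : Finset ℝ) (u : ℝ → ℝ) (t : ℝ) (γ : ℝ → ℝ) (b : ℝ) : ℝ :=
  truncated B u t γ b / ∑ c ∈ nearBest B u t, γ c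

theorem truncated_nonneg (B : Finset ℝ) (u : ℝ → ℝ) (t : ℝ) (γ : ℝ → ℝ) (hγ : IsDist B γ)
    (b : ℝ) : 0 ≤ truncated B u t γ b := by
  unfold truncated
  split_ifs
  exacts [hγ.1 b, le_rfl]

theorem truncated_le (B : Finset ℝ) (u : ℝ → ℝ) (t : ℝ) (γ : ℝ → ℝ) (hγ : IsDist B γ)
    (b : ℝ) : truncated B u t γ b ≤ γ b := by
  unfold truncated
  split_ifs
  exacts [le_rfl, hγ.1 b]

theorem truncated_le_conditioned (B : Finset ℝ) (u : ℝ → ℝ) (t : ℝ) (γ : ℝ → ℝ)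
    (hγ : IsDist B γ) (hpos : 0 < ∑ c ∈ nearBest B u t, γ c) (b : ℝ) :
    truncated B u t γ b ≤ conditioned B u t γ b := by
  refine le_div_self (truncated_nonneg B u t γ hγ b) hpos ?_
  rw [← sum_truncated, ← hγ.2]
  exact Finset.sum_le_sum fun b _ => truncated_le B u t γ hγ b

theorem isDist_conditioned (B : Finset ℝ) (u : ℝ → ℝ) (t : ℝ) (γ : ℝ → ℝ)
    (hγ : IsDist B γ) (hpos : 0 < ∑ c ∈ nearBest B u t, γ c) :
    IsDist B (conditioned B u t γ) := by
  refine ⟨fun b => div_nonneg (truncated_nonneg B u t γ hγ b) hpos.le, ?_⟩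
  unfold conditioned
  rw [← Finset.sum_div, sum_truncated, div_self hpos.ne']

theorem conditioned_eq_zero (B : Finset ℝ) (u : ℝ → ℝ) (t : ℝ) (γ : ℝ → ℝ) (b : ℝ)
    (h : γ b = 0) : conditioned B u t γ b = 0 := by
  simp [conditioned, truncated, h]

theorem mem_nearBest_of_conditioned_pos (B : Finset ℝ) (u : ℝ → ℝ) (t : ℝ) (γ : ℝ → ℝ) (b : ℝ)
    (h : 0 < conditioned B u t γ b) : b ∈ nearBest B u t := by
  by_contra hb
  simp [conditioned, truncated, hb] at h

/-- In a DFPA with interaction degree bounded by `d ∈ {1,…,n-1}`,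
any non-overbidding `(ε²/(8d))`-approximate MBNE `β` can be turned into a
non-overbidding ε-well-supported MBNE `β'` whose supports are contained in those of
`β`; consequently `β'` is monotone whenever `β` is, and symmetric (for iid auctions)
whenever `β` is. -/
theorem stmt6 (n : ℕ) (hn : 2 ≤ n) (V : Fin n → Finset ℝ) (B : Finset ℝ)
    (hV : ∀ i, ↑(V i) ⊆ Set.Icc (0:ℝ) 1) (hB : ↑B ⊆ Set.Icc (0:ℝ) 1) (h0B : (0:ℝ) ∈ B)
    (f : Fin n → Fin n → ℝ → ℝ) (hf : IsPrior n V f)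
    (d : ℕ) (hd1 : 1 ≤ d) (hdn : d ≤ n - 1)
    (hdeg : ∀ i : Fin n, ∃ J : Finset (Fin n), J.card ≤ d ∧ i ∉ J ∧
      ∀ j : Fin n, j ≠ i → j ∉ J → (0:ℝ) ∈ V j ∧ f i j 0 = 1)
    (ε : ℝ) (hε0 : 0 ≤ ε) (hε1 : ε ≤ 1)
    (β : Fin n → ℝ → ℝ → ℝ) (hβ : IsMixedProfile n V B β)
    (hno : NonOverbidding n V B β)
    (heq : MBNE n V B f β (ε ^ 2 / (8 * (d : ℝ)))) :
    ∃ β' : Fin n → ℝ → ℝ → ℝ,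
      IsMixedProfile n V B β' ∧
      NonOverbidding n V B β' ∧
      WSMBNE n V B f β' ε ∧
      (∀ i : Fin n, ∀ v ∈ V i, ∀ b ∈ B, 0 < β' i v b → 0 < β i v b) ∧
      ((∀ i, MonotoneStrat (V i) B (β i)) → ∀ i, MonotoneStrat (V i) B (β' i)) ∧
      (((∃ (V0 : Finset ℝ) (f0 : ℝ → ℝ), (∀ i, V i = V0) ∧
            ∀ i j : Fin n, i ≠ j → f i j = f0) ∧
          (∀ i i' : Fin n, β i = β i')) →
        ∀ i i' : Fin n, β' i = β' i') := by
  have hd0 : (0 : ℝ) < d := by exact_mod_cast hd1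
  set ρ : Fin n → ℝ → ℝ → ℝ := fun i v =>
    truncated B (fun b => interim n V B f β i b v) (ε / 2) (β i v) with hρ
  set β' : Fin n → ℝ → ℝ → ℝ := fun i v =>
    conditioned B (fun b => interim n V B f β i b v) (ε / 2) (β i v) with hβ'
  have hmass : ∀ i, ∀ v ∈ V i, 1 - ε / (4 * d) ≤
      ∑ b ∈ nearBest B (fun b => interim n V B f β i b v) (ε / 2), β i v b := fun i v hv =>
    one_sub_le_sum_nearBest B _ _ (hβ i v hv) d ε hε0 (heq i v hv)
  have hsmall : ε / (4 * d) ≤ 1 / 4 := by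
    have : (1 : ℝ) ≤ d := by exact_mod_cast hd1
    rw [div_le_iff₀ (by positivity)]
    linarith
  have hpos : ∀ i, ∀ v ∈ V i,
      0 < ∑ b ∈ nearBest B (fun b => interim n V B f β i b v) (ε / 2), β i v b :=
    fun i v hv => by linarith [hmass i v hv]
  have hprof : IsMixedProfile n V B β' := fun i v hv =>
    isDist_conditioned B _ _ _ (hβ i v hv) (hpos i v hv)
  have hsupp : ∀ i : Fin n, ∀ v ∈ V i, ∀ b ∈ B, 0 < β' i v b → 0 < β i v b := by
    intro i v hv b _ hb
    refine lt_of_le_of_ne ((hβ i v hv).1 b) fun h => hb.ne' ?_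
    exact conditioned_eq_zero B _ _ _ b h.symm
  have hloss : ∀ i j : Fin n, j ≠ i →
      1 - ∑ w ∈ V j, f i j w * ∑ x ∈ B, ρ j w x ≤ ε / (4 * d) := by
    intro i j hj
    obtain ⟨hf0, -, hf1⟩ := hf i j hj.symm
    have : ∑ w ∈ V j, f i j w * (1 - ε / (4 * d)) ≤ ∑ w ∈ V j, f i j w * ∑ x ∈ B, ρ j w x := by
      refine Finset.sum_le_sum fun w hw => mul_le_mul_of_nonneg_left ?_ (hf0 w)
      rw [hρ, sum_truncated]
      exact hmass j w hw
    rw [← Finset.sum_mul, hf1] at this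
    linarith
  have hzero : ∀ i j : Fin n, j ≠ i → (0 : ℝ) ∈ V j → f i j 0 = 1 →
      1 - ∑ w ∈ V j, f i j w * ∑ x ∈ B, ρ j w x = 0 := by
    intro i j hj h0 hf01
    obtain ⟨hf0, -, hf1⟩ := hf i j hj.symm
    have hoff : ∀ w ∈ V j, w ≠ 0 → f i j w = 0 := by
      rw [← Finset.add_sum_erase _ _ h0, hf01, add_eq_left,
        Finset.sum_eq_zero_iff_of_nonneg fun w _ => hf0 w] at hf1
      exact fun w hw hw0 => hf1 w (Finset.mem_erase.2 ⟨hw0, hw⟩)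
    have hbid : ∀ b ∈ B, b ≠ 0 → β j 0 b = 0 := fun b hb hb0 =>
      hno j 0 h0 b hb (lt_of_le_of_ne (hB hb).1 hb0.symm)
    have hβ0 : β j 0 0 = 1 := by
      rw [← (hβ j 0 h0).2, Finset.sum_eq_single_of_mem 0 h0B hbid]
    have hmem : (0 : ℝ) ∈ nearBest B (fun b => interim n V B f β j b 0) (ε / 2) := by
      by_contra hmem
      refine (hpos j 0 h0).ne' (Finset.sum_eq_zero fun b hb => ?_)
      exact hbid b (Finset.mem_filter.1 hb).1 fun h => hmem (h ▸ hb)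
    rw [Finset.sum_eq_single_of_mem 0 h0 fun w hw hw0 => by rw [hoff w hw hw0, zero_mul], hf01,
      hρ, sum_truncated, Finset.sum_eq_single_of_mem 0 hmem fun b hb hb0 =>
        hbid b (Finset.mem_filter.1 hb).1 hb0, hβ0]
    norm_num
  have htotal : ∀ i : Fin n,
      ∑ j, (1 - if j = i then 1 else ∑ w ∈ V j, f i j w * ∑ x ∈ B, ρ j w x) ≤ ε / 4 := by
    intro i
    obtain ⟨J, hJ, hiJ, hJ0⟩ := hdeg i
    rw [← Finset.sum_subset (Finset.subset_univ J)]
    · calc _ ≤ ∑ _j ∈ J, ε / (4 * d) := by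
            refine Finset.sum_le_sum fun j hj => ?_
            have hji : j ≠ i := fun h => hiJ (h ▸ hj)
            rw [if_neg hji]
            exact hloss i j hji
        _ = J.card * (ε / (4 * d)) := by rw [Finset.sum_const, nsmul_eq_mul]
        _ ≤ d * (ε / (4 * d)) := by
            refine mul_le_mul_of_nonneg_right ?_ (by positivity)
            exact_mod_cast hJ
        _ = ε / 4 := by field_simp
    · intro j _ hj
      by_cases hji : j = i
      · simp [hji]
      · rw [if_neg hji]
        exact hzero i j hji (hJ0 j hji hj).1 (hJ0 j hji hj).2
  have hclose : ∀ i, ∀ v ∈ V i, ∀ b ∈ B,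
      |interim n V B f β i b v - interim n V B f β' i b v| ≤ ε / 4 := by
    intro i v hv b hb
    refine (abs_interim_sub_le n V B f hf ρ β β' hβ hprof
      (fun j w hw x => truncated_nonneg B _ _ _ (hβ j w hw) x)
      (fun j w hw x => truncated_le B _ _ _ (hβ j w hw) x)
      (fun j w hw x => truncated_le_conditioned B _ _ _ (hβ j w hw) (hpos j w hw) x)
      i b v ?_).trans (htotal i)
    have h1 := hV i hv
    have h2 := hB hb
    rw [abs_le]
    constructor <;> linarith [h1.1, h1.2, h2.1, h2.2]
  refine ⟨β', hprof, ?_, ?_, hsupp, ?_, ?_⟩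
  · exact fun i v hv b hb hlt => conditioned_eq_zero B _ _ _ b (hno i v hv b hb hlt)
  · intro i v hv b hb hbpos γ hγ
    have hbest := (Finset.mem_filter.1 (mem_nearBest_of_conditioned_pos B _ _ _ b hbpos)).2
    have hb' := (abs_le.1 (hclose i v hv b hb)).2
    have hle : interimMix n V B f β' i γ v
        ≤ ∑ c ∈ B, γ c * (interim n V B f β' i b v + ε) := by
      refine Finset.sum_le_sum fun c hc => mul_le_mul_of_nonneg_left ?_ (hγ.1 c)
      have hc' := (abs_le.1 (hclose i v hv c hc)).1
      have := hbest c hc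
      linarith
    rw [← Finset.sum_mul, hγ.2] at hle
    linarith
  · intro hmono i v hv v' hv' hlt b hb b' hb' hpb hpb'
    exact hmono i v hv v' hv' hlt b hb b' hb' (hsupp i v hv b hb hpb)
      (hsupp i v' hv' b' hb' hpb')
  · rintro ⟨⟨V0, f0, hV0, hf0⟩, hsym⟩ i i'
    funext v
    simp only [hβ', hsym i i', interim_eq_of_symmetric n V B f β V0 f0 hV0 hf0 hsym i i']
end

section
/- Let a discrete first-price auction have iid priors, and suppose that for every ε > 0 it has a symmetric, monotone, non-overbidding ε-approximate mixed Bayes–Nash equilibrium. Then it has a symmetric, monotone, non-overbidding exact (0-approximate) mixed Bayes–Nash equilibrium. -/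
open Finset

/-- The interim utility only depends on the strategies at opponents' values and at bids in `B`. -/
theorem interim_congr {n : ℕ} {V : Fin n → Finset ℝ} {B : Finset ℝ}
    {f : Fin n → Fin n → ℝ → ℝ} {β β' : Fin n → ℝ → ℝ → ℝ}
    (h : ∀ j, ∀ w ∈ V j, ∀ b ∈ B, β j w b = β' j w b) (i : Fin n) (b v : ℝ) :
    interim n V B f β i b v = interim n V B f β' i b v := by
  unfold interim
  refine Finset.sum_congr rfl fun bb hbb => ?_
  congr 1
  refine Finset.prod_congr rfl fun j hj => Finset.sum_congr rfl fun w hw => ?_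
  have hmem := Fintype.mem_piFinset.1 hbb j
  rw [if_neg (Finset.ne_of_mem_erase hj)] at hmem
  rw [h j w hw _ hmem]

theorem interimMix_congr {n : ℕ} {V : Fin n → Finset ℝ} {B : Finset ℝ}
    {f : Fin n → Fin n → ℝ → ℝ} {β β' : Fin n → ℝ → ℝ → ℝ} {γ γ' : ℝ → ℝ}
    (h : ∀ j, ∀ w ∈ V j, ∀ b ∈ B, β j w b = β' j w b) (hγ : ∀ b ∈ B, γ b = γ' b)
    (i : Fin n) (v : ℝ) :
    interimMix n V B f β i γ v = interimMix n V B f β' i γ' v :=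
  Finset.sum_congr rfl fun b hb => by rw [hγ b hb, interim_congr h]

/-- The interim utility is continuous in the profile and in the bidder's own mixed bid. -/
theorem Continuous.interimMix {X : Type*} [TopologicalSpace X] {n : ℕ} {V : Fin n → Finset ℝ}
    {B : Finset ℝ} {f : Fin n → Fin n → ℝ → ℝ} {β : X → Fin n → ℝ → ℝ → ℝ} {γ : X → ℝ → ℝ}
    (hβ : Continuous β) (hγ : Continuous γ) (i : Fin n) (v : ℝ) :
    Continuous fun x => interimMix n V B f (β x) i (γ x) v := by
  unfold _root_.interimMix interim
  fun_prop

theorem IsDist.le_one {B : Finset ℝ} {γ : ℝ → ℝ} (h : IsDist B γ) {b : ℝ} (hb : b ∈ B) :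
    γ b ≤ 1 :=
  h.2 ▸ Finset.single_le_sum (fun c _ => h.1 c) hb

theorem isClosed_setOf_isDist (B : Finset ℝ) : IsClosed {γ : ℝ → ℝ | IsDist B γ} := by
  simp only [IsDist, Set.ofPred_and, Set.ofPred_forall]
  exact (isClosed_iInter fun b => isClosed_le (by fun_prop) (by fun_prop)).inter
    (isClosed_eq (by fun_prop) (by fun_prop))

/-- For nonnegative strategies, monotonicity is the vanishing of products of probabilities. -/
theorem monotoneStrat_iff {V B : Finset ℝ} {β : ℝ → ℝ → ℝ} (h : ∀ v ∈ V, ∀ b, 0 ≤ β v b) :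
    MonotoneStrat V B β ↔
      ∀ v ∈ V, ∀ v' ∈ V, v < v' → ∀ b ∈ B, ∀ b' ∈ B, b' < b → β v b * β v' b' = 0 := by
  refine forall₂_congr fun v hv => forall₃_congr fun v' hv' _ =>
    forall₂_congr fun b _ => forall₂_congr fun b' _ => ?_
  constructor
  · intro H hlt
    by_contra hne
    obtain ⟨h1, h2⟩ := mul_ne_zero_iff.1 hne
    exact hlt.not_ge (H ((h v hv b).lt_of_ne' h1) ((h v' hv' b').lt_of_ne' h2))
  · intro H h1 h2
    by_contra! hlt
    exact (mul_pos h1 h2).ne' (H hlt)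

/-- Strategies vanishing off `V × B` whose symmetric profile is a monotone, non-overbidding
`ε`-approximate equilibrium under iid priors. -/
def symmetricEquilibria (n : ℕ) (V B : Finset ℝ) (f : ℝ → ℝ) (ε : ℝ) : Set (ℝ → ℝ → ℝ) :=
  {β | (∀ v b, ¬(v ∈ V ∧ b ∈ B) → β v b = 0) ∧ (∀ v ∈ V, IsDist B (β v)) ∧
    MonotoneStrat V B β ∧ (∀ v ∈ V, ∀ b ∈ B, v < b → β v b = 0) ∧
    MBNE n (fun _ => V) B (fun _ _ => f) (fun _ => β) ε}

theorem isClosed_symmetricEquilibria (n : ℕ) (V B : Finset ℝ) (f : ℝ → ℝ) (ε : ℝ) :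
    IsClosed (symmetricEquilibria n V B f ε) := by
  have hset : symmetricEquilibria n V B f ε =
      {β | (∀ v b, ¬(v ∈ V ∧ b ∈ B) → β v b = 0) ∧ (∀ v ∈ V, IsDist B (β v)) ∧
        (∀ v ∈ V, ∀ v' ∈ V, v < v' → ∀ b ∈ B, ∀ b' ∈ B, b' < b → β v b * β v' b' = 0) ∧
        (∀ v ∈ V, ∀ b ∈ B, v < b → β v b = 0) ∧
        MBNE n (fun _ => V) B (fun _ _ => f) (fun _ => β) ε} := by
    ext β
    refine and_congr_right fun _ => and_congr_right fun h => ?_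
    exact and_congr_left fun _ => monotoneStrat_iff fun v hv => (h v hv).1
  rw [hset]
  simp only [MBNE, Set.ofPred_and, Set.ofPred_forall]
  refine .inter ?_ (.inter ?_ (.inter ?_ (.inter ?_ ?_)))
  · exact isClosed_iInter fun v => isClosed_iInter fun b => isClosed_iInter fun _ =>
      isClosed_eq (by fun_prop) (by fun_prop)
  · exact isClosed_iInter fun v => isClosed_iInter fun _ =>
      (isClosed_setOf_isDist B).preimage (f := fun β : ℝ → ℝ → ℝ => β v) (by fun_prop)
  · refine isClosed_iInter fun v => isClosed_iInter fun _ => isClosed_iInter fun v' =>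
      isClosed_iInter fun _ => isClosed_iInter fun _ => isClosed_iInter fun b =>
      isClosed_iInter fun _ => isClosed_iInter fun b' => isClosed_iInter fun _ =>
      isClosed_iInter fun _ => isClosed_eq (by fun_prop) (by fun_prop)
  · exact isClosed_iInter fun v => isClosed_iInter fun _ => isClosed_iInter fun b =>
      isClosed_iInter fun _ => isClosed_iInter fun _ => isClosed_eq (by fun_prop) (by fun_prop)
  · refine isClosed_iInter fun i => isClosed_iInter fun v => isClosed_iInter fun _ =>
      isClosed_iInter fun γ => isClosed_iInter fun _ => isClosed_le ?_ ?_
    · exact (Continuous.interimMix (by fun_prop) continuous_const i v).sub continuous_const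
    · exact Continuous.interimMix (by fun_prop) (by fun_prop) i v

theorem isCompact_symmetricEquilibria (n : ℕ) (V B : Finset ℝ) (f : ℝ → ℝ) (ε : ℝ) :
    IsCompact (symmetricEquilibria n V B f ε) := by
  have hK : IsCompact (Set.univ.pi fun _ : ℝ => Set.univ.pi fun _ : ℝ => Set.Icc (0 : ℝ) 1) :=
    isCompact_univ_pi fun _ => isCompact_univ_pi fun _ => isCompact_Icc
  refine hK.of_isClosed_subset (isClosed_symmetricEquilibria n V B f ε) ?_
  rintro β ⟨hzero, hdist, -⟩ v - b -
  by_cases h : v ∈ V ∧ b ∈ B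
  · exact ⟨(hdist v h.1).1 b, (hdist v h.1).le_one h.2⟩
  · simp [hzero v b h]

theorem symmetricEquilibria_mono {n : ℕ} {V B : Finset ℝ} {f : ℝ → ℝ} {ε δ : ℝ} (h : ε ≤ δ) :
    symmetricEquilibria n V B f ε ⊆ symmetricEquilibria n V B f δ := by
  rintro β ⟨h1, h2, h3, h4, h5⟩
  exact ⟨h1, h2, h3, h4, fun i v hv γ hγ => by linarith [h5 i v hv γ hγ]⟩

open Classical in
/-- Setting a strategy to zero off `V × B` preserves being a symmetric equilibrium. -/
theorem truncate_mem_symmetricEquilibria {n : ℕ} {V B : Finset ℝ} {f : ℝ → ℝ} {ε : ℝ}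
    {β : ℝ → ℝ → ℝ} (hdist : ∀ v ∈ V, IsDist B (β v)) (hmono : MonotoneStrat V B β)
    (hover : ∀ v ∈ V, ∀ b ∈ B, v < b → β v b = 0)
    (heq : MBNE n (fun _ => V) B (fun _ _ => f) (fun _ => β) ε) :
    (fun v b => if v ∈ V ∧ b ∈ B then β v b else 0) ∈ symmetricEquilibria n V B f ε := by
  set β' : ℝ → ℝ → ℝ := fun v b => if v ∈ V ∧ b ∈ B then β v b else 0
  have hagree : ∀ v ∈ V, ∀ b ∈ B, β' v b = β v b := fun v hv b hb => if_pos ⟨hv, hb⟩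
  refine ⟨fun v b h => if_neg h, fun v hv => ⟨fun b => ?_, ?_⟩, ?_, ?_, ?_⟩
  · dsimp only [β']
    split_ifs
    exacts [(hdist v hv).1 b, le_rfl]
  · rw [Finset.sum_congr rfl (hagree v hv), (hdist v hv).2]
  · intro v hv v' hv' hlt b hb b' hb'
    rw [hagree v hv b hb, hagree v' hv' b' hb']
    exact hmono v hv v' hv' hlt b hb b' hb'
  · intro v hv b hb
    rw [hagree v hv b hb]
    exact hover v hv b hb
  · intro i v hv γ hγ
    rw [interimMix_congr (fun _ => hagree) (hagree v hv),
      interimMix_congr (fun _ => hagree) fun _ _ => rfl]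
    exact heq i v hv γ hγ

/-- **Convergence Lemma.** If a DFPA with iid priors has a symmetric,
monotone, non-overbidding ε-approximate mixed Bayes–Nash equilibrium for every
`ε > 0`, then it has a symmetric, monotone, non-overbidding exact MBNE. -/
theorem stmt7 (n : ℕ) (hn : 2 ≤ n) (V0 B : Finset ℝ)
    (hV : ↑V0 ⊆ Set.Icc (0:ℝ) 1) (hB : ↑B ⊆ Set.Icc (0:ℝ) 1) (h0B : (0:ℝ) ∈ B)
    (f0 : ℝ → ℝ) (hf0nn : ∀ v, 0 ≤ f0 v) (hf0supp : ∀ v, v ∉ V0 → f0 v = 0)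
    (hf0sum : ∑ v ∈ V0, f0 v = 1)
    (happrox : ∀ ε : ℝ, 0 < ε → ∃ β0 : ℝ → ℝ → ℝ,
      (∀ v ∈ V0, IsDist B (β0 v)) ∧
      MonotoneStrat V0 B β0 ∧
      (∀ v ∈ V0, ∀ b ∈ B, v < b → β0 v b = 0) ∧
      MBNE n (fun _ => V0) B (fun _ _ => f0) (fun _ => β0) ε) :
    ∃ β0 : ℝ → ℝ → ℝ,
      (∀ v ∈ V0, IsDist B (β0 v)) ∧
      MonotoneStrat V0 B β0 ∧
      (∀ v ∈ V0, ∀ b ∈ B, v < b → β0 v b = 0) ∧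
      MBNE n (fun _ => V0) B (fun _ _ => f0) (fun _ => β0) 0 := by
  obtain ⟨β, hβ⟩ := IsCompact.nonempty_iInter_of_sequence_nonempty_isCompact_isClosed
    (fun k : ℕ => symmetricEquilibria n V0 B f0 (1 / (k + 1)))
    (fun k => symmetricEquilibria_mono (by
      simpa using Nat.one_div_le_one_div (α := ℝ) (Nat.le_succ k)))
    (fun k => by
      obtain ⟨β, h1, h2, h3, h4⟩ := happrox (1 / (k + 1)) Nat.one_div_pos_of_nat
      exact ⟨_, truncate_mem_symmetricEquilibria h1 h2 h3 h4⟩)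
    (isCompact_symmetricEquilibria n V0 B f0 _)
    (fun k => isClosed_symmetricEquilibria n V0 B f0 _)
  rw [Set.mem_iInter] at hβ
  obtain ⟨-, h1, h2, h3, -⟩ := hβ 0
  refine ⟨β, h1, h2, h3, fun i v hv γ hγ => ?_⟩
  have hlim := (tendsto_one_div_add_atTop_nhds_zero_nat (𝕜 := ℝ)).const_sub
    (interimMix n (fun _ => V0) B (fun _ _ => f0) (fun _ => β) i γ v)
  exact le_of_tendsto' hlim fun k => (hβ k).2.2.2.2 i v hv γ hγ
end

section
/- Consider a discrete first-price auction with n ≥ 1000 bidders and bidding space B = {0, 1/4, 1/2, 3/4}, in which every bidder's value space contains 0, and with three designated bidders c₁, c₂ and κ such that: c₁ and c₂ each have value space {0, 1/2} and believe (with probability 1) that every other bidder has value 0; and κ has value space {0, 1}, believes (with probability 1) that c₁ and c₂ each have value 1/2, and believes (with probability 1) that every other bidder has value 0. Then in every non-overbidding ε-well-supported mixed Bayes–Nash equilibrium β with 0 ≤ ε < 1/36, bidder c₁ bids 1/4 with probability 1 at value 1/2 (β_{c₁}(1/2)(1/4) = 1), likewise β_{c₂}(1/2)(1/4) = 1, and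 bidder κ bids 1/2 with probability 1 at value 1 (β_{κ}(1)(1/2) = 1). -/
open Finset

theorem exPost_eq_of_forall_lt {n : ℕ} {i : Fin n} {v : ℝ} {bb : Fin n → ℝ}
    (h : ∀ k, k ≠ i → bb k < bb i) : exPost n i v bb = v - bb i := by
  have hmax : ∀ k, bb k ≤ bb i := fun k => by
    rcases eq_or_ne k i with rfl | hk
    · exact le_rfl
    · exact (h k hk).le
  have hW : (Finset.univ.filter (fun j : Fin n => ∀ k, bb k ≤ bb j)) = {i} := by
    ext j
    simp only [mem_filter, mem_univ, true_and, mem_singleton]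
    constructor
    · intro hj
      by_contra hne
      exact absurd (hj i) (not_le.mpr (h j hne))
    · rintro rfl
      exact hmax
  rw [exPost, if_pos hmax, hW]
  simp

theorem exPost_eq_zero_of_lt {n : ℕ} {i k : Fin n} {v : ℝ} {bb : Fin n → ℝ}
    (h : bb i < bb k) : exPost n i v bb = 0 :=
  if_neg fun hmax => absurd (hmax k) (not_le.mpr h)

/-- A bidder whose bid is matched or exceeded on `S` wins with probability at most `1 / |S|`. -/
theorem exPost_le_div_card {n : ℕ} {i : Fin n} {v : ℝ} {bb : Fin n → ℝ} {S : Finset (Fin n)}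
    (hS : S.Nonempty) (h : ∀ k ∈ S, bb i ≤ bb k) (hv : bb i ≤ v) :
    exPost n i v bb ≤ (v - bb i) / (S.card : ℝ) := by
  have hv' : 0 ≤ v - bb i := sub_nonneg.mpr hv
  rw [exPost]
  split_ifs with hmax
  · refine div_le_div_of_nonneg_left hv' (by exact_mod_cast hS.card_pos) ?_
    exact_mod_cast card_le_card fun k hk =>
      mem_filter.mpr ⟨mem_univ k, fun l => (hmax l).trans (h k hk)⟩
  · positivity

theorem interim_eq_exPost_of_pure {n : ℕ} {V : Fin n → Finset ℝ} {B : Finset ℝ}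
    {f : Fin n → Fin n → ℝ → ℝ} {β : Fin n → ℝ → ℝ → ℝ} {i : Fin n} {a : Fin n → ℝ}
    (haB : ∀ j, j ≠ i → a j ∈ B)
    (ha : ∀ j, j ≠ i → ∀ x ∈ B, ∑ w ∈ V j, f i j w * β j w x = if x = a j then 1 else 0)
    (b v : ℝ) :
    interim n V B f β i b v = exPost n i v (Function.update a i b) := by
  rw [interim, Finset.sum_eq_single (Function.update a i b)]
  · rw [Finset.prod_eq_one, one_mul]
    intro j hj
    have hji := ne_of_mem_erase hj
    rw [Function.update_of_ne hji, ha j hji _ (haB j hji), if_pos rfl]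
  · intro bb hbb hne
    rw [Fintype.mem_piFinset] at hbb
    obtain ⟨j, hj⟩ := Function.ne_iff.mp hne
    have hji : j ≠ i := by
      rintro rfl
      have := hbb j
      simp at this
      simp [this] at hj
    have hbj := hbb j
    rw [if_neg hji] at hbj
    rw [Function.update_of_ne hji] at hj
    rw [Finset.prod_eq_zero (mem_erase.mpr ⟨hji, mem_univ j⟩), zero_mul]
    rw [ha j hji _ hbj, if_neg hj]
  · intro hnot
    refine absurd (Fintype.mem_piFinset.mpr fun j => ?_) hnot
    rcases eq_or_ne j i with rfl | hj
    · simp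
    · simpa [hj] using haB j hj

theorem Finset.eq_zero_of_sum_eq_one {s : Finset ℝ} {p : ℝ → ℝ} {x y : ℝ}
    (hp : ∀ z, 0 ≤ p z) (hs : ∑ z ∈ s, p z = 1) (hx : x ∈ s) (hpx : p x = 1)
    (hy : y ∈ s) (hyx : y ≠ x) : p y = 0 := by
  rw [← Finset.add_sum_erase s p hx, hpx] at hs
  have h0 : ∑ z ∈ s.erase x, p z = 0 := by linarith
  exact (Finset.sum_eq_zero_iff_of_nonneg fun z _ => hp z).mp h0 y (mem_erase.mpr ⟨hyx, hy⟩)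

/-- If bidder `i` is certain that `j` has value `w`, at which `j` bids `a` for sure, then
`i` believes that `j` bids `a`. -/
theorem sum_prior_mul_eq_ite {n : ℕ} {V : Fin n → Finset ℝ} {B : Finset ℝ}
    {f : Fin n → Fin n → ℝ → ℝ} {β : Fin n → ℝ → ℝ → ℝ} {i j : Fin n} {w a : ℝ}
    (hf : IsPrior n V f) (hβ : IsMixedProfile n V B β) (hij : i ≠ j) (hw : w ∈ V j)
    (hfw : f i j w = 1) (haB : a ∈ B) (ha : β j w a = 1) {x : ℝ} (hx : x ∈ B) :
    ∑ u ∈ V j, f i j u * β j u x = if x = a then 1 else 0 := by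
  obtain ⟨hf0, -, hf1⟩ := hf i j hij
  rw [Finset.sum_eq_single_of_mem w hw fun u hu huw => by
    rw [eq_zero_of_sum_eq_one hf0 hf1 hw hfw hu huw, zero_mul], hfw, one_mul]
  split_ifs with h
  · rw [h, ha]
  · exact eq_zero_of_sum_eq_one (hβ j w hw).1 (hβ j w hw).2 haB ha hx h

theorem IsDist.eq_one_of_forall_eq_zero {B : Finset ℝ} {γ : ℝ → ℝ} {a : ℝ}
    (hγ : IsDist B γ) (ha : a ∈ B) (h : ∀ b ∈ B, b ≠ a → γ b = 0) : γ a = 1 := by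
  rw [← hγ.2, Finset.sum_eq_single_of_mem a ha h]

/-- A bid that beats every other bid by more than `ε` is played with probability one. -/
theorem WSMBNE.eq_one_of_forall_interim_lt {n : ℕ} {V : Fin n → Finset ℝ} {B : Finset ℝ}
    {f : Fin n → Fin n → ℝ → ℝ} {β : Fin n → ℝ → ℝ → ℝ} {ε : ℝ} {i : Fin n} {v a : ℝ}
    (hws : WSMBNE n V B f β ε) (hβ : IsMixedProfile n V B β) (hv : v ∈ V i) (ha : a ∈ B)
    (h : ∀ b ∈ B, b ≠ a → interim n V B f β i b v < interim n V B f β i a v - ε) :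
    β i v a = 1 := by
  refine (hβ i v hv).eq_one_of_forall_eq_zero ha fun b hb hba => ?_
  by_contra hne
  have hpos : 0 < β i v b := lt_of_le_of_ne ((hβ i v hv).1 b) (Ne.symm hne)
  have hdist : IsDist B (fun x => if x = a then 1 else 0) :=
    ⟨fun x => by dsimp only; split_ifs <;> norm_num, by simp [ha]⟩
  have hmix : interimMix n V B f β i (fun x => if x = a then 1 else 0) v
      = interim n V B f β i a v := by
    simp [interimMix, ha]
  have := hws i v hv b hb hpos _ hdist
  rw [hmix] at this
  linarith [h b hb hba]

theorem NonOverbidding.bid_zero {n : ℕ} {V : Fin n → Finset ℝ} {B : Finset ℝ}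
    {β : Fin n → ℝ → ℝ → ℝ} (hno : NonOverbidding n V B β) (hβ : IsMixedProfile n V B β)
    (hB : ∀ b ∈ B, 0 ≤ b) (hB0 : (0 : ℝ) ∈ B) {j : Fin n} (hj : (0 : ℝ) ∈ V j) :
    β j 0 0 = 1 :=
  (hβ j 0 hj).eq_one_of_forall_eq_zero hB0 fun b hb hb0 =>
    hno j 0 hj b hb (lt_of_le_of_ne (hB b hb) (Ne.symm hb0))

/-- A bidder with value `1/2` who is certain that all others have value `0` bids `1/4`. -/
theorem bid_quarter_of_all_others_zero {n : ℕ} (hn : 1000 ≤ n) {V : Fin n → Finset ℝ}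
    (hV0 : ∀ i, (0 : ℝ) ∈ V i) {f : Fin n → Fin n → ℝ → ℝ} (hf : IsPrior n V f) {c : Fin n}
    (hc : (1 / 2 : ℝ) ∈ V c) (hfc : ∀ j : Fin n, j ≠ c → f c j 0 = 1) {ε : ℝ}
    (hε : ε < 1 / 36) {β : Fin n → ℝ → ℝ → ℝ}
    (hβ : IsMixedProfile n V ({0, 1/4, 1/2, 3/4} : Finset ℝ) β)
    (hno : NonOverbidding n V ({0, 1/4, 1/2, 3/4} : Finset ℝ) β)
    (hws : WSMBNE n V ({0, 1/4, 1/2, 3/4} : Finset ℝ) f β ε) :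
    β c (1/2) (1/4) = 1 := by
  have hinterim := interim_eq_exPost_of_pure (V := V) (f := f) (β := β)
    (B := ({0, 1/4, 1/2, 3/4} : Finset ℝ)) (i := c) (a := fun _ => 0) (fun _ _ => by simp)
    fun j hj x hx => sum_prior_mul_eq_ite hf hβ hj.symm (hV0 j) (hfc j hj) (by simp)
      (hno.bid_zero hβ (fun b hb => by
        simp only [mem_insert, mem_singleton] at hb
        rcases hb with rfl | rfl | rfl | rfl <;> norm_num) (by simp) (hV0 j)) hx
  have hpos : ∀ b : ℝ, 0 < b →
      exPost n c (1/2) (Function.update (fun _ => (0 : ℝ)) c b) = 1/2 - b := fun b hb => by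
    rw [exPost_eq_of_forall_lt fun k hk => by simpa [hk] using hb, Function.update_self]
  have hzero : exPost n c (1/2) (Function.update (fun _ => (0 : ℝ)) c 0) ≤ 1/2000 := by
    have h := exPost_le_div_card (i := c) (v := 1/2)
      (bb := Function.update (fun _ => (0 : ℝ)) c 0) (S := univ) ⟨c, mem_univ c⟩
      (fun k _ => by simp [Function.update_apply]) (by simp)
    simp only [Function.update_self, card_univ, Fintype.card_fin, sub_zero] at h
    refine h.trans ?_
    have hn' : (1000 : ℝ) ≤ n := by exact_mod_cast hn
    rw [div_le_iff₀ (by linarith)]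
    linarith
  refine hws.eq_one_of_forall_interim_lt hβ hc (by simp) fun b hb hne => ?_
  rw [hinterim, hinterim, hpos (1/4) (by norm_num)]
  simp only [mem_insert, mem_singleton] at hb
  rcases hb with rfl | rfl | rfl | rfl
  · linarith
  · exact absurd rfl hne
  · rw [hpos _ (by norm_num)]; linarith
  · rw [hpos _ (by norm_num)]; linarith

/-- In a DFPA with `n ≥ 1000` bidders, bid space `{0,1/4,1/2,3/4}`,
`0` in every value space, and designated bidders `c₁, c₂, κ` as described (the
"constant bidder" gadget), in every non-overbidding ε-well-supported MBNE with
`0 ≤ ε < 1/36` bidders `c₁, c₂` bid `1/4` with probability 1 at value `1/2`, and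
bidder `κ` bids `1/2` with probability 1 at value `1`. -/
theorem stmt17 (n : ℕ) (hn : 1000 ≤ n) (V : Fin n → Finset ℝ)
    (hV : ∀ i, ↑(V i) ⊆ Set.Icc (0:ℝ) 1) (hV0 : ∀ i, (0:ℝ) ∈ V i)
    (f : Fin n → Fin n → ℝ → ℝ)
    (hf : IsPrior n V f)
    (c₁ c₂ κ : Fin n) (h12 : c₁ ≠ c₂) (h1k : c₁ ≠ κ) (h2k : c₂ ≠ κ)
    (hVc1 : V c₁ = ({0, 1/2} : Finset ℝ)) (hVc2 : V c₂ = ({0, 1/2} : Finset ℝ))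
    (hVκ : V κ = ({0, 1} : Finset ℝ))
    (hfc1 : ∀ j : Fin n, j ≠ c₁ → f c₁ j 0 = 1)
    (hfc2 : ∀ j : Fin n, j ≠ c₂ → f c₂ j 0 = 1)
    (hfκ1 : f κ c₁ (1/2) = 1) (hfκ2 : f κ c₂ (1/2) = 1)
    (hfκ : ∀ j : Fin n, j ≠ κ → j ≠ c₁ → j ≠ c₂ → f κ j 0 = 1)
    (ε : ℝ) (hε0 : 0 ≤ ε) (hε : ε < 1/36)
    (β : Fin n → ℝ → ℝ → ℝ)
    (hβ : IsMixedProfile n V ({0, 1/4, 1/2, 3/4} : Finset ℝ) β)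
    (hno : NonOverbidding n V ({0, 1/4, 1/2, 3/4} : Finset ℝ) β)
    (hws : WSMBNE n V ({0, 1/4, 1/2, 3/4} : Finset ℝ) f β ε) :
    β c₁ (1/2) (1/4) = 1 ∧ β c₂ (1/2) (1/4) = 1 ∧ β κ 1 (1/2) = 1 := by
  have hc1 := bid_quarter_of_all_others_zero hn hV0 hf (by simp [hVc1]) hfc1 hε hβ hno hws
  have hc2 := bid_quarter_of_all_others_zero hn hV0 hf (by simp [hVc2]) hfc2 hε hβ hno hws
  refine ⟨hc1, hc2, ?_⟩
  set a : Fin n → ℝ := fun j => if j = c₁ ∨ j = c₂ then 1/4 else 0 with ha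
  have ha_le : ∀ j, a j ≤ 1/4 := fun j => by simp only [ha]; split_ifs <;> norm_num
  have hinterim := interim_eq_exPost_of_pure (V := V) (f := f) (β := β)
    (B := ({0, 1/4, 1/2, 3/4} : Finset ℝ)) (i := κ) (a := a)
    (fun j _ => by simp only [ha]; split_ifs <;> simp)
    fun j hj x hx => by
      by_cases h1 : j = c₁
      · subst h1
        simpa [ha] using sum_prior_mul_eq_ite hf hβ hj.symm (by simp [hVc1]) hfκ1
          (by simp) hc1 hx
      by_cases h2 : j = c₂
      · subst h2
        simpa [ha] using sum_prior_mul_eq_ite hf hβ hj.symm (by simp [hVc2]) hfκ2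
          (by simp) hc2 hx
      simpa [ha, h1, h2] using sum_prior_mul_eq_ite hf hβ hj.symm (hV0 j) (hfκ j hj h1 h2)
        (by simp) (hno.bid_zero hβ (fun b hb => by
          simp only [mem_insert, mem_singleton] at hb
          rcases hb with rfl | rfl | rfl | rfl <;> norm_num) (by simp) (hV0 j)) hx
  have hhigh : ∀ b : ℝ, 1/4 < b → exPost n κ 1 (Function.update a κ b) = 1 - b :=
    fun b hb => by
      rw [exPost_eq_of_forall_lt fun k hk => by
        simpa only [Function.update_of_ne hk, Function.update_self] using
          (ha_le k).trans_lt hb, Function.update_self]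
  have hzero : exPost n κ 1 (Function.update a κ 0) = 0 :=
    exPost_eq_zero_of_lt (k := c₁) (by
      rw [Function.update_self, Function.update_of_ne h1k]
      simp [ha])
  have hquarter : exPost n κ 1 (Function.update a κ (1/4)) ≤ (1 - 1/4) / 2 := by
    have h := exPost_le_div_card (i := κ) (v := 1) (bb := Function.update a κ (1/4))
      (S := {c₁, c₂}) ⟨c₁, by simp⟩ (fun k hk => by
        have hk' : k = c₁ ∨ k = c₂ := by simpa using hk
        have hkκ : k ≠ κ := by rcases hk' with rfl | rfl <;> assumption
        simp only [Function.update_of_ne hkκ, Function.update_self, ha, if_pos hk', le_refl])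
      (by rw [Function.update_self]; norm_num)
    rw [Function.update_self, card_pair h12] at h
    exact_mod_cast h
  refine hws.eq_one_of_forall_interim_lt hβ (by simp [hVκ]) (by simp) fun b hb hne => ?_
  rw [hinterim, hinterim, hhigh (1/2) (by norm_num)]
  simp only [mem_insert, mem_singleton] at hb
  rcases hb with rfl | rfl | rfl | rfl
  · rw [hzero]; linarith
  · linarith
  · exact absurd rfl hne
  · rw [hhigh _ (by norm_num)]; linarith
end
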